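/- Let β⃗ be sub-critical and X ~ ERGM(β⃗) on 𝒢_n. For every fixed positive integer k there is a constant C > 0 such that for all sufficiently large n and any k distinct edges i_1,…,i_k of K_n no two of which share a vertex, |𝔼[(X_{i_1} − 𝔼 X_{i_1})(X_{i_2} − 𝔼 X_{i_2}) ⋯ (X_{i_k} − 𝔼 X_{i_k})]| ≤ C n^{-k/2}. -/

import Mathlib

open Finset MeasureTheory Filter
open scoped ENNReal NNReal

namespace ERGM

/-- The set of edges of the complete graph on `Fin n`: non-diagonal unordered pairs. -/
abbrev EdgeSet (n : ℕ) : Type := {p : Sym2 (Fin n) // ¬ p.IsDiag}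

/-- A configuration (graph on `n` vertices): an assignment of `true/false` to each edge. -/
abbrev Config (n : ℕ) : Type := EdgeSet n → Bool

/-- The value of the configuration `x` on the (unordered) pair `{i,j}`; `false` for `i = j`. -/
noncomputable def edgeVal {n : ℕ} (x : Config n) (i j : Fin n) : Bool :=
  if h : (s(i, j) : Sym2 (Fin n)).IsDiag then false else x ⟨s(i, j), h⟩

/-- Real-valued indicator of presence of the edge `{i,j}` in `x`. -/
noncomputable def edgeInd {n : ℕ} (x : Config n) (i j : Fin n) : ℝ :=
  if edgeVal x i j = true then 1 else 0

open scoped Classical in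
/-- Subgraph counting number `N_G(x)`: the number of copies of `G` in `x` (times the
number of automorphisms), i.e. the sum over injective `ψ` of the product of edge
indicators (each edge indicator is idempotent, so counting ordered adjacent pairs
yields the same value as counting edges). -/
noncomputable def NG {n m : ℕ} (G : SimpleGraph (Fin m)) (x : Config n) : ℝ :=
  ∑ ψ : Fin m ↪ Fin n, ∏ a : Fin m, ∏ b : Fin m,
    if G.Adj a b then edgeInd x (ψ a) (ψ b) else 1

/-- The Hamiltonian `H(x) = Σ_i β_i N_{G_i}(x) / n^{|V_i|-2}`. -/
noncomputable def Hamiltonian {n s : ℕ} (V : Fin s → ℕ)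
    (G : ∀ i, SimpleGraph (Fin (V i))) (β : Fin s → ℝ) (x : Config n) : ℝ :=
  ∑ i, β i * NG (G i) x / (n : ℝ) ^ (V i - 2)

/-- The ERGM probability mass function `π(x) ∝ exp(H(x))`. -/
noncomputable def ergmProb {n s : ℕ} (V : Fin s → ℕ)
    (G : ∀ i, SimpleGraph (Fin (V i))) (β : Fin s → ℝ) (x : Config n) : ℝ :=
  Real.exp (Hamiltonian V G β x) / ∑ y : Config n, Real.exp (Hamiltonian V G β y)

/-- Expectation of `f` with respect to the mass function `w`. -/
noncomputable def expect {n : ℕ} (w : Config n → ℝ) (f : Config n → ℝ) : ℝ :=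
  ∑ x : Config n, w x * f x

open scoped Classical in
/-- Probability of the event `A` with respect to the mass function `w`. -/
noncomputable def prob {n : ℕ} (w : Config n → ℝ) (A : Config n → Prop) : ℝ :=
  ∑ x : Config n, if A x then w x else 0

/-- The number of edges `|E(G)|` of a finite graph. -/
noncomputable def numEdges {m : ℕ} (G : SimpleGraph (Fin m)) : ℕ := G.edgeSet.ncard

/-- `Ψ_β(p) = Σ_i 2 β_i |E_i| p^{|E_i|-1}`. -/
noncomputable def Psi {s : ℕ} (V : Fin s → ℕ) (G : ∀ i, SimpleGraph (Fin (V i)))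
    (β : Fin s → ℝ) (p : ℝ) : ℝ :=
  ∑ i, 2 * β i * (numEdges (G i) : ℝ) * p ^ (numEdges (G i) - 1)

/-- `Φ(u) = e^u / (1 + e^u)`. -/
noncomputable def Phi (u : ℝ) : ℝ := Real.exp u / (1 + Real.exp u)

/-- `φ_β(p) = Φ(Ψ_β(p))`. -/
noncomputable def phiFn {s : ℕ} (V : Fin s → ℕ) (G : ∀ i, SimpleGraph (Fin (V i)))
    (β : Fin s → ℝ) : ℝ → ℝ := fun p => Phi (Psi V G β p)

/-- `β` is sub-critical (high temperature) with fixed point `p`: `p` is the unique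
solution of `φ_β(p) = p` and it satisfies `φ_β'(p) < 1`. -/
def Subcritical {s : ℕ} (V : Fin s → ℕ) (G : ∀ i, SimpleGraph (Fin (V i)))
    (β : Fin s → ℝ) (p : ℝ) : Prop :=
  phiFn V G β p = p ∧ (∀ q : ℝ, phiFn V G β q = q → q = p) ∧
    deriv (phiFn V G β) p < 1

/-- The discrete derivative `∂_e H(x) = H(x_{e+}) - H(x_{e-})`. -/
noncomputable def dHam {n s : ℕ} (V : Fin s → ℕ) (G : ∀ i, SimpleGraph (Fin (V i)))
    (β : Fin s → ℝ) (e : EdgeSet n) (x : Config n) : ℝ :=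
  Hamiltonian V G β (Function.update x e true) - Hamiltonian V G β (Function.update x e false)

/-- Real-valued indicator `X_e` of presence of edge `e`. -/
noncomputable def edgeX {n : ℕ} (e : EdgeSet n) (x : Config n) : ℝ := if x e = true then 1 else 0

/-- Two edges of `K_n` share a vertex. -/
def ShareVertex {n : ℕ} (e f : EdgeSet n) : Prop := ∃ v : Fin n, v ∈ e.1 ∧ v ∈ f.1

section FiniteMean

variable {Ω : Type*} [Fintype Ω]

/-- The mean of `f` under the probability mass function proportional to `w`. -/
noncomputable def mean (w : Ω → ℝ) : (Ω → ℝ) →ₗ[ℝ] ℝ where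
  toFun f := (∑ x, w x * f x) / ∑ x, w x
  map_add' f g := by simp only [Pi.add_apply, mul_add, sum_add_distrib, add_div]
  map_smul' c f := by
    simp only [Pi.smul_apply, smul_eq_mul, RingHom.id_apply, mul_left_comm _ c, ← mul_sum,
      mul_div_assoc]

lemma mean_apply (w f : Ω → ℝ) : mean w f = (∑ x, w x * f x) / ∑ x, w x := rfl

/-- The covariance of `f` and `g` under the probability mass function proportional to `w`. -/
noncomputable def covar (w : Ω → ℝ) : (Ω → ℝ) →ₗ[ℝ] (Ω → ℝ) →ₗ[ℝ] ℝ :=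
  (LinearMap.mul ℝ (Ω → ℝ)).compr₂ (mean w) -
    (LinearMap.mul ℝ ℝ).compl₁₂ (mean w) (mean w)

lemma covar_apply (w f g : Ω → ℝ) :
    covar w f g = mean w (f * g) - mean w f * mean w g := by
  simp [covar]

lemma covar_comm (w f g : Ω → ℝ) : covar w f g = covar w g f := by
  simp only [covar_apply, mul_comm]

lemma sum_pos_of_weight_pos [Nonempty Ω] {w : Ω → ℝ} (hw : ∀ x, 0 < w x) : 0 < ∑ x, w x :=
  sum_pos (fun x _ ↦ hw x) univ_nonempty

lemma mean_mono [Nonempty Ω] {w f g : Ω → ℝ} (hw : ∀ x, 0 < w x) (h : f ≤ g) :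
    mean w f ≤ mean w g := by
  rw [mean_apply, mean_apply]
  exact div_le_div_of_nonneg_right
    (sum_le_sum fun x _ ↦ mul_le_mul_of_nonneg_left (h x) (hw x).le) (sum_pos_of_weight_pos hw).le

lemma mean_nonneg [Nonempty Ω] {w f : Ω → ℝ} (hw : ∀ x, 0 < w x) (h : 0 ≤ f) :
    0 ≤ mean w f := by
  simpa using mean_mono hw h

lemma mean_const [Nonempty Ω] {w : Ω → ℝ} (hw : ∀ x, 0 < w x) (c : ℝ) :
    mean w (fun _ ↦ c) = c := by
  rw [mean_apply, ← sum_mul, mul_div_cancel_left₀ _ (sum_pos_of_weight_pos hw).ne']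

lemma abs_mean_le [Nonempty Ω] {w : Ω → ℝ} (hw : ∀ x, 0 < w x) (f : Ω → ℝ) :
    |mean w f| ≤ mean w |f| :=
  abs_le.2 ⟨by rw [← map_neg]; exact mean_mono hw fun x ↦ neg_abs_le (f x),
    mean_mono hw fun x ↦ le_abs_self (f x)⟩

lemma mean_comp_equiv {w : Ω → ℝ} (T : Ω ≃ Ω) (hT : ∀ x, w (T x) = w x) (f : Ω → ℝ) :
    mean w (f ∘ T) = mean w f := by
  rw [mean_apply, mean_apply, ← T.sum_comp fun x ↦ w x * f x]
  simp only [hT, Function.comp_apply]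

lemma covar_comp_equiv {w : Ω → ℝ} (T : Ω ≃ Ω) (hT : ∀ x, w (T x) = w x) (f g : Ω → ℝ) :
    covar w (f ∘ T) (g ∘ T) = covar w f g := by
  rw [covar_apply, covar_apply, mean_comp_equiv T hT, mean_comp_equiv T hT,
    ← mean_comp_equiv T hT (f * g)]
  rfl

lemma mean_sub_const_sq [Nonempty Ω] {w : Ω → ℝ} (hw : ∀ x, 0 < w x) (f : Ω → ℝ) (u : ℝ) :
    mean w (fun x ↦ (f x - u) ^ 2) = covar w f f + (mean w f - u) ^ 2 := by
  have h : (fun x ↦ (f x - u) ^ 2) = f * f - (2 * u) • f + fun _ ↦ u ^ 2 := by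
    ext x; simp; ring
  rw [h, map_add, map_sub, map_smul, mean_const hw, covar_apply, smul_eq_mul]
  ring

lemma covar_const_left [Nonempty Ω] {w : Ω → ℝ} (hw : ∀ x, 0 < w x) (c : ℝ) (g : Ω → ℝ) :
    covar w (fun _ ↦ c) g = 0 := by
  have h : (fun _ ↦ c) * g = c • g := rfl
  rw [covar_apply, mean_const hw, h, map_smul, smul_eq_mul, sub_self]

variable [DistribLattice Ω]

/-- Positive association of log-supermodular weights. -/
lemma covar_nonneg [Nonempty Ω] [OrderBot Ω] {w : Ω → ℝ} (hw : ∀ x, 0 < w x)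
    (hsm : ∀ x y, w x * w y ≤ w (x ⊓ y) * w (x ⊔ y)) {f g : Ω → ℝ} (hf : Monotone f)
    (hg : Monotone g) : 0 ≤ covar w f g := by
  have hZ := sum_pos_of_weight_pos hw
  have key : 0 ≤ covar w (f - fun _ ↦ f ⊥) (g - fun _ ↦ g ⊥) := by
    have := fkg (μ := w) (f := f - fun _ ↦ f ⊥) (g := g - fun _ ↦ g ⊥) (fun x ↦ (hw x).le)
      (fun x ↦ sub_nonneg.2 (hf bot_le)) (fun x ↦ sub_nonneg.2 (hg bot_le))
      (fun x y h ↦ sub_le_sub_right (hf h) _) (fun x y h ↦ sub_le_sub_right (hg h) _) hsm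
    rw [covar_apply, mean_apply, mean_apply, mean_apply, sub_nonneg, div_mul_div_comm,
      div_le_div_iff₀ (by positivity) hZ]
    simp only [Pi.mul_apply]
    nlinarith
  simpa only [map_sub, LinearMap.sub_apply, covar_const_left hw, covar_comm w _ fun _ ↦ g ⊥,
    sub_zero] using key

lemma mean_le_mean_of_monotone_ratio [Nonempty Ω] [OrderBot Ω] {w g f : Ω → ℝ}
    (hw : ∀ x, 0 < w x) (hsm : ∀ x y, w x * w y ≤ w (x ⊓ y) * w (x ⊔ y)) (hg : Monotone g)
    (hg0 : ∀ x, 0 < g x) (hf : Monotone f) : mean w f ≤ mean (w * g) f := by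
  have h := covar_nonneg hw hsm hf hg
  have hZ := sum_pos_of_weight_pos hw
  have hZ' : 0 < ∑ x, w x * g x := sum_pos_of_weight_pos fun x ↦ mul_pos (hw x) (hg0 x)
  rw [covar_apply, mean_apply, mean_apply, mean_apply, sub_nonneg, div_mul_div_comm,
    div_le_div_iff₀ (by positivity) hZ] at h
  rw [mean_apply, mean_apply]
  simp only [Pi.mul_apply] at h ⊢
  rw [div_le_div_iff₀ hZ hZ']
  simp only [mul_right_comm (w _) (g _), mul_assoc (w _) (f _)]
  nlinarith

end FiniteMean

section Gibbs

variable {ι J : Type*} [Fintype J]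

/-- The indicator that all edges of `S` are present. -/
noncomputable def present (S : Finset ι) (x : ι → Bool) : ℝ :=
  open scoped Classical in if ∀ e ∈ S, x e = true then 1 else 0

lemma present_of_forall {S : Finset ι} {x : ι → Bool} (h : ∀ e ∈ S, x e = true) :
    present S x = 1 := if_pos h

lemma present_of_not_forall {S : Finset ι} {x : ι → Bool} (h : ¬ ∀ e ∈ S, x e = true) :
    present S x = 0 := if_neg h

lemma present_eq_zero_or_one (S : Finset ι) (x : ι → Bool) :
    present S x = 0 ∨ present S x = 1 := by
  rw [present]; split_ifs <;> simp

lemma present_nonneg (S : Finset ι) (x : ι → Bool) : 0 ≤ present S x := by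
  rcases present_eq_zero_or_one S x with h | h <;> simp [h]

lemma present_le_one (S : Finset ι) (x : ι → Bool) : present S x ≤ 1 := by
  rcases present_eq_zero_or_one S x with h | h <;> simp [h]

lemma present_monotone (S : Finset ι) : Monotone (present S) := by
  intro x y h
  by_cases hx : ∀ e ∈ S, x e = true
  · have hy : ∀ e ∈ S, y e = true := fun e he ↦
      Bool.eq_true_of_true_le (hx e he ▸ h e)
    rw [present_of_forall hx, present_of_forall hy]
  · rw [present_of_not_forall hx]; exact present_nonneg S y

lemma present_empty : present (∅ : Finset ι) = 1 := by
  ext x; simp [present]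

lemma present_union [DecidableEq ι] (S T : Finset ι) :
    present (S ∪ T) = present S * present T := by
  ext x
  by_cases hS : ∀ e ∈ S, x e = true
  · by_cases hT : ∀ e ∈ T, x e = true
    · rw [Pi.mul_apply, present_of_forall hS, present_of_forall hT, present_of_forall, one_mul]
      intro e he
      exact (mem_union.1 he).elim (hS e) (hT e)
    · rw [Pi.mul_apply, present_of_not_forall hT, present_of_not_forall, mul_zero]
      exact fun h ↦ hT fun e he ↦ h e (mem_union_right _ he)
  · rw [Pi.mul_apply, present_of_not_forall hS, present_of_not_forall, zero_mul]
    exact fun h ↦ hS fun e he ↦ h e (mem_union_left _ he)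

lemma present_insert [DecidableEq ι] (e : ι) (S : Finset ι) :
    present (insert e S) = present {e} * present S := by
  rw [insert_eq, present_union]

lemma present_inf_add_sup (S : Finset ι) (x y : ι → Bool) :
    present S x + present S y ≤ present S (x ⊓ y) + present S (x ⊔ y) := by
  by_cases hx : ∀ e ∈ S, x e = true
  · by_cases hy : ∀ e ∈ S, y e = true
    · rw [present_of_forall hx, present_of_forall hy, present_of_forall, present_of_forall]
      · simp +contextual [hx]
      · simp +contextual [hx, hy]
    · rw [present_of_not_forall hy]
      linarith [present_monotone S (le_sup_left : x ≤ x ⊔ y), present_nonneg S (x ⊓ y)]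
  · rw [present_of_not_forall hx]
    linarith [present_monotone S (le_sup_right : y ≤ x ⊔ y), present_nonneg S (x ⊓ y)]

lemma present_singleton_inf_add_sup (e : ι) (x y : ι → Bool) :
    present {e} (x ⊓ y) + present {e} (x ⊔ y) = present {e} x + present {e} y := by
  cases hx : x e <;> cases hy : y e <;> simp [present, hx, hy]

/-- The sum over `e ∈ S` of the single-edge indicators dominates the increments of `present S`. -/
lemma sum_present_sub_present_monotone (S : Finset ι) :
    Monotone (∑ e ∈ S, present {e} - present S) := by
  classical
  intro x y h
  have hle : ∀ e ∈ S, present {e} x ≤ present {e} y := fun e _ ↦ present_monotone {e} h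
  simp only [Pi.sub_apply, Finset.sum_apply]
  by_cases hx : ∀ e ∈ S, x e = true
  · have := sum_le_sum hle
    have h1 := present_of_forall hx
    have h2 := present_le_one S y
    linarith
  · by_cases hy : ∀ e ∈ S, y e = true
    · push Not at hx
      obtain ⟨e, he, hxe⟩ := hx
      have hlt := sum_le_sum fun f (hf : f ∈ S.erase e) ↦ hle f (mem_of_mem_erase hf)
      have h1 : present {e} x = 0 := present_of_not_forall (by simpa using hxe)
      have h2 : present {e} y = 1 := present_of_forall (by simpa using hy e he)
      rw [← add_sum_erase S (fun f ↦ present {f} x) he,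
        ← add_sum_erase S (fun f ↦ present {f} y) he, h1, h2]
      linarith [present_nonneg S x, present_le_one S y]
    · rw [present_of_not_forall hx, present_of_not_forall hy]
      simpa using sum_le_sum hle

variable [Fintype ι]

/-- The Gibbs weight with interactions `c j * present (S j)` and external field `t`. -/
noncomputable def gibbsWeight (c : J → ℝ) (S : J → Finset ι) (t : ι → ℝ) (x : ι → Bool) : ℝ :=
  Real.exp (∑ j, c j * present (S j) x + ∑ e, t e * present {e} x)

variable {c : J → ℝ} {S : J → Finset ι} {t : ι → ℝ}

lemma gibbsWeight_pos (x : ι → Bool) : 0 < gibbsWeight c S t x := Real.exp_pos _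

lemma gibbsWeight_supermodular (hc : ∀ j, 0 ≤ c j) (x y : ι → Bool) :
    gibbsWeight c S t x * gibbsWeight c S t y ≤
      gibbsWeight c S t (x ⊓ y) * gibbsWeight c S t (x ⊔ y) := by
  simp only [gibbsWeight, ← Real.exp_add]
  apply Real.exp_le_exp.2
  have h1 : ∑ j, c j * present (S j) x + ∑ j, c j * present (S j) y ≤
      ∑ j, c j * present (S j) (x ⊓ y) + ∑ j, c j * present (S j) (x ⊔ y) := by
    simp only [← sum_add_distrib, ← mul_add]
    exact sum_le_sum fun j _ ↦ mul_le_mul_of_nonneg_left (present_inf_add_sup _ _ _) (hc j)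
  have h2 : ∑ e, t e * present {e} x + ∑ e, t e * present {e} y =
      ∑ e, t e * present {e} (x ⊓ y) + ∑ e, t e * present {e} (x ⊔ y) := by
    simp only [← sum_add_distrib, ← mul_add, present_singleton_inf_add_sup]
  linarith

lemma gibbsWeight_eq_mul (t t' : ι → ℝ) :
    gibbsWeight c S t' =
      gibbsWeight c S t * fun x ↦ Real.exp (∑ e, (t' e - t e) * present {e} x) := by
  ext x
  simp only [gibbsWeight, Pi.mul_apply, ← Real.exp_add, sub_mul, sum_sub_distrib]
  ring_nf

variable [DecidableEq ι]

lemma covar_gibbsWeight_nonneg (hc : ∀ j, 0 ≤ c j) {f g : (ι → Bool) → ℝ} (hf : Monotone f)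
    (hg : Monotone g) : 0 ≤ covar (gibbsWeight c S t) f g :=
  covar_nonneg gibbsWeight_pos (gibbsWeight_supermodular hc) hf hg

lemma mean_gibbsWeight_mono (hc : ∀ j, 0 ≤ c j) {t' : ι → ℝ} (h : t ≤ t')
    {f : (ι → Bool) → ℝ} (hf : Monotone f) :
    mean (gibbsWeight c S t) f ≤ mean (gibbsWeight c S t') f := by
  rw [gibbsWeight_eq_mul t t']
  refine mean_le_mean_of_monotone_ratio gibbsWeight_pos (gibbsWeight_supermodular hc)
    (fun x y hxy ↦ Real.exp_le_exp.2 <| sum_le_sum fun e _ ↦ ?_) (fun _ ↦ Real.exp_pos _) hf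
  exact mul_le_mul_of_nonneg_left (present_monotone _ hxy) (sub_nonneg.2 (h e))

end Gibbs

section LocalField

variable {ι J : Type*} [DecidableEq ι] [Fintype J]
  {c : J → ℝ} {S : J → Finset ι} {t : ι → ℝ}

/-- The change of the interaction energy caused by adding the edge `e`. -/
noncomputable def localField (c : J → ℝ) (S : J → Finset ι) (e : ι) : (ι → Bool) → ℝ :=
  ∑ j with e ∈ S j, c j • present ((S j).erase e)

/-- The total interaction strength of the sets containing both `e` and `f`. -/
noncomputable def pairCoeff (c : J → ℝ) (S : J → Finset ι) (e f : ι) : ℝ :=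
  ∑ j with e ∈ S j ∧ f ∈ S j, c j

lemma pairCoeff_self (c : J → ℝ) (S : J → Finset ι) (e : ι) :
    pairCoeff c S e e = ∑ j with e ∈ S j, c j := by simp only [pairCoeff, and_self]

lemma pairCoeff_nonneg (hc : ∀ j, 0 ≤ c j) (e f : ι) : 0 ≤ pairCoeff c S e f :=
  sum_nonneg fun j _ ↦ hc j

lemma localField_monotone (hc : ∀ j, 0 ≤ c j) (e : ι) : Monotone (localField c S e) := by
  intro x y h
  simp only [localField, Finset.sum_apply, Pi.smul_apply, smul_eq_mul]
  exact sum_le_sum fun j _ ↦ mul_le_mul_of_nonneg_left (present_monotone _ h) (hc j)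

lemma localField_nonneg (hc : ∀ j, 0 ≤ c j) (e : ι) (x : ι → Bool) : 0 ≤ localField c S e x := by
  simp only [localField, Finset.sum_apply, Pi.smul_apply, smul_eq_mul]
  exact sum_nonneg fun j _ ↦ mul_nonneg (hc j) (present_nonneg _ x)

lemma localField_le (hc : ∀ j, 0 ≤ c j) (e : ι) (x : ι → Bool) :
    localField c S e x ≤ pairCoeff c S e e := by
  simp only [localField, Finset.sum_apply, Pi.smul_apply, smul_eq_mul, pairCoeff_self]
  exact sum_le_sum fun j _ ↦ mul_le_of_le_one_right (hc j) (present_le_one _ x)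

lemma present_update_true (T : Finset ι) (e : ι) (x : ι → Bool) :
    present T (Function.update x e true) = present (T.erase e) x := by
  have h : (∀ f ∈ T, Function.update x e true f = true) ↔ ∀ f ∈ T.erase e, x f = true := by
    refine forall_congr' fun f ↦ ?_
    by_cases hf : f = e
    · simp [hf]
    · simp [hf]
  exact if_congr h rfl rfl

variable [Fintype ι]

lemma covar_present_le_sum (hc : ∀ j, 0 ≤ c j) {g : (ι → Bool) → ℝ} (hg : Monotone g)
    (T : Finset ι) :
    covar (gibbsWeight c S t) g (present T) ≤
      ∑ e ∈ T, covar (gibbsWeight c S t) g (present {e}) := by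
  have h := covar_gibbsWeight_nonneg (S := S) (t := t) hc hg (sum_present_sub_present_monotone T)
  rw [map_sub, map_sum] at h
  linarith

lemma abs_mean_present_sub_pow_le (hc : ∀ j, 0 ≤ c j) {m κ : ℝ}
    (hm : ∀ e, mean (gibbsWeight c S t) (present {e}) = m) (hm0 : 0 ≤ m) (hm1 : m ≤ 1)
    (hκ : ∀ e f, e ≠ f → covar (gibbsWeight c S t) (present {e}) (present {f}) ≤ κ)
    (hκ0 : 0 ≤ κ) (T : Finset ι) :
    |mean (gibbsWeight c S t) (present T) - m ^ #T| ≤ (#T : ℝ) ^ 2 * κ := by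
  induction T using Finset.induction_on with
  | empty =>
    have h1 : mean (gibbsWeight c S t) (1 : (ι → Bool) → ℝ) = 1 := mean_const gibbsWeight_pos 1
    simp [present_empty, h1]
  | insert e T he ih =>
    rw [card_insert_of_notMem he, present_insert]
    have h1 : covar (gibbsWeight c S t) (present {e}) (present T) ≤ #T * κ :=
      (covar_present_le_sum hc (present_monotone _) T).trans <| by
        rw [← nsmul_eq_mul, ← sum_const]
        exact sum_le_sum fun f hf ↦ hκ e f (ne_of_mem_of_not_mem hf he).symm
    have h0 := covar_gibbsWeight_nonneg (S := S) (t := t) hc (present_monotone {e})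
      (present_monotone T)
    rw [covar_apply, hm] at h0 h1
    rw [abs_le] at ih ⊢
    have hT : (0 : ℝ) ≤ #T := Nat.cast_nonneg _
    have hTκ : 0 ≤ #T * κ := mul_nonneg hT hκ0
    have hT2 : 0 ≤ (#T : ℝ) ^ 2 * κ := by positivity
    push_cast
    rw [pow_succ m]
    constructor <;>
      nlinarith [mul_le_mul_of_nonneg_left ih.1 hm0, mul_le_mul_of_nonneg_left ih.2 hm0,
        mul_le_mul_of_nonneg_right hm1 hT2]

lemma sum_mul_sum_erase (c : J → ℝ) (S : J → Finset ι) (e : ι) (a : ι → ℝ) :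
    ∑ j with e ∈ S j, c j * ∑ f ∈ (S j).erase e, a f =
      ∑ f ∈ univ.erase e, pairCoeff c S e f * a f := by
  simp only [pairCoeff, mul_sum, sum_mul]
  refine sum_comm' fun j f ↦ ?_
  simp only [mem_filter, mem_univ, true_and, mem_erase]
  tauto

lemma sum_pairCoeff_erase_le (hc : ∀ j, 0 ≤ c j) {r : ℕ} (hr : ∀ j, #(S j) ≤ r) (e : ι) :
    ∑ f ∈ univ.erase e, pairCoeff c S e f ≤ r * pairCoeff c S e e := by
  have h := sum_mul_sum_erase c S e 1
  simp only [Pi.one_apply, mul_one] at h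
  rw [← h, pairCoeff_self, mul_sum]
  refine sum_le_sum fun j _ ↦ ?_
  rw [mul_comm, sum_const, nsmul_eq_mul, mul_one]
  exact mul_le_mul_of_nonneg_right (by exact_mod_cast (card_erase_le).trans (hr j)) (hc j)

lemma covar_localField_le (hc : ∀ j, 0 ≤ c j) {g : (ι → Bool) → ℝ} (hg : Monotone g) (e : ι) :
    covar (gibbsWeight c S t) g (localField c S e) ≤
      ∑ f ∈ univ.erase e, pairCoeff c S e f * covar (gibbsWeight c S t) g (present {f}) := by
  rw [← sum_mul_sum_erase, localField, map_sum]
  refine sum_le_sum fun j _ ↦ ?_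
  rw [map_smul, smul_eq_mul]
  exact mul_le_mul_of_nonneg_left (covar_present_le_sum hc hg _) (hc j)

lemma gibbsWeight_update_true {e : ι} {x : ι → Bool} (hx : x e = false) :
    gibbsWeight c S t (Function.update x e true) =
      gibbsWeight c S t x * Real.exp (localField c S e x + t e) := by
  have hzero : ∀ T : Finset ι, present T (Function.update x e true) =
      present T x + if e ∈ T then present (T.erase e) x else 0 := by
    intro T
    rw [present_update_true]
    split_ifs with h
    · rw [present_of_not_forall (S := T) fun H ↦ by simp [H e h] at hx, zero_add]
    · rw [erase_eq_of_notMem h, add_zero]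
  simp only [gibbsWeight, ← Real.exp_add, hzero, mul_add, sum_add_distrib, localField,
    Finset.sum_apply, Pi.smul_apply, smul_eq_mul, sum_filter, mul_ite, mul_zero, mem_singleton]
  have h1 : ∑ f, (if e = f then t f * present (({f} : Finset ι).erase e) x else 0) = t e := by
    rw [sum_ite_eq, if_pos (mem_univ e), erase_singleton, present_empty, Pi.one_apply, mul_one]
  rw [h1]
  ring_nf

/-- The Gibbs (DLR) identity at the edge `e`. -/
lemma mean_present_singleton_eq (e : ι) :
    mean (gibbsWeight c S t) (present {e}) =
      mean (gibbsWeight c S t)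
        fun x ↦ (1 - present {e} x) * Real.exp (localField c S e x + t e) := by
  have hinv : Function.Involutive fun x : ι → Bool ↦ Function.update x e (!x e) := by
    intro x
    simp
  rw [mean_apply, mean_apply, ← Equiv.sum_comp hinv.toPerm]
  congr 1
  refine sum_congr rfl fun x _ ↦ ?_
  simp only [Function.Involutive.coe_toPerm]
  cases hx : x e with
  | true =>
    rw [present_of_not_forall (by simp), present_of_forall (by simpa using hx)]
    simp
  | false =>
    rw [Bool.not_false, gibbsWeight_update_true hx, present_of_forall (by simp),
      present_of_not_forall (S := {e}) (x := x) (by simp [hx])]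
    ring

lemma covar_localField_self_le (hc : ∀ j, 0 ≤ c j) {κ α A : ℝ} (e : ι)
    (hκ : ∀ f g, f ≠ g → covar (gibbsWeight c S t) (present {f}) (present {g}) ≤ κ)
    (hκ0 : 0 ≤ κ) (hα : ∀ f, f ≠ e → pairCoeff c S e f ≤ α) (hα0 : 0 ≤ α)
    (hA : ∑ f ∈ univ.erase e, pairCoeff c S e f ≤ A) :
    covar (gibbsWeight c S t) (localField c S e) (localField c S e) ≤ A * (α + A * κ) := by
  have hA0 : 0 ≤ A := (sum_nonneg fun f _ ↦ pairCoeff_nonneg hc e f).trans hA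
  have hself : ∀ f, covar (gibbsWeight c S t) (present {f}) (present {f}) ≤ 1 := by
    intro f
    rw [covar_apply, ← present_union, union_idempotent]
    have h1 : mean (gibbsWeight c S t) (present {f}) ≤ 1 :=
      (mean_mono gibbsWeight_pos (present_le_one {f})).trans_eq (mean_const gibbsWeight_pos 1)
    nlinarith [mul_self_nonneg (mean (gibbsWeight c S t) (present {f}))]
  have hinner : ∀ f ∈ univ.erase e,
      covar (gibbsWeight c S t) (localField c S e) (present {f}) ≤ α + A * κ := by
    intro f hf
    rw [covar_comm]
    refine (covar_localField_le hc (present_monotone _) e).trans ?_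
    rw [← add_sum_erase _ _ hf]
    have h1 : pairCoeff c S e f * covar (gibbsWeight c S t) (present {f}) (present {f}) ≤ α :=
      (mul_le_of_le_one_right (pairCoeff_nonneg hc e f) (hself f)).trans
        (hα f (ne_of_mem_erase hf))
    have h2 : ∑ g ∈ (univ.erase e).erase f,
        pairCoeff c S e g * covar (gibbsWeight c S t) (present {f}) (present {g}) ≤ A * κ := by
      refine le_trans (sum_le_sum fun g hg ↦ mul_le_mul_of_nonneg_left
        (hκ f g (ne_of_mem_erase hg).symm) (pairCoeff_nonneg hc e g)) ?_
      rw [← sum_mul]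
      refine mul_le_mul_of_nonneg_right (le_trans ?_ hA) hκ0
      exact sum_le_sum_of_subset_of_nonneg (erase_subset _ _)
        fun g _ _ ↦ pairCoeff_nonneg hc e g
    exact add_le_add h1 h2
  refine (covar_localField_le hc (localField_monotone hc e) e).trans ?_
  refine (sum_le_sum fun f hf ↦ mul_le_mul_of_nonneg_left (hinner f hf)
    (pairCoeff_nonneg hc e f)).trans ?_
  rw [← sum_mul]
  exact mul_le_mul_of_nonneg_right hA (by positivity)

lemma abs_mean_localField_sub_le (hc : ∀ j, 0 ≤ c j) {m κ D δ u : ℝ} {r : ℕ} (e : ι)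
    (hm : ∀ e, mean (gibbsWeight c S t) (present {e}) = m) (hm0 : 0 ≤ m) (hm1 : m ≤ 1)
    (hκ : ∀ f g, f ≠ g → covar (gibbsWeight c S t) (present {f}) (present {g}) ≤ κ)
    (hκ0 : 0 ≤ κ) (hr : ∀ j, #(S j) ≤ r) (hD : pairCoeff c S e e ≤ D)
    (hu : |∑ j with e ∈ S j, c j * m ^ (#(S j) - 1) - u| ≤ δ) :
    |mean (gibbsWeight c S t) (localField c S e) - u| ≤ D * (r ^ 2 * κ) + δ := by
  refine (abs_sub_le _ (∑ j with e ∈ S j, c j * m ^ (#(S j) - 1)) u).trans (add_le_add ?_ hu)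
  rw [localField, map_sum, ← sum_sub_distrib]
  refine (abs_sum_le_sum_abs _ _).trans ?_
  have hterm : ∀ j ∈ ({j | e ∈ S j} : Finset J),
      |mean (gibbsWeight c S t) (c j • present ((S j).erase e)) - c j * m ^ (#(S j) - 1)| ≤
        c j * (r ^ 2 * κ) := by
    intro j hj
    rw [map_smul, smul_eq_mul, ← mul_sub, abs_mul, abs_of_nonneg (hc j),
      ← card_erase_of_mem (mem_filter.1 hj).2]
    refine mul_le_mul_of_nonneg_left
      ((abs_mean_present_sub_pow_le hc hm hm0 hm1 hκ hκ0 _).trans ?_) (hc j)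
    have : #((S j).erase e) ≤ r := card_erase_le.trans (hr j)
    gcongr
  refine (sum_le_sum hterm).trans ?_
  rw [← sum_mul, ← pairCoeff_self]
  exact mul_le_mul_of_nonneg_right hD (by positivity)

/-- Mean-field equation for the marginal of an edge, with an explicit error. -/
lemma abs_marginal_sub_Phi_le (hc : ∀ j, 0 ≤ c j) {m κ α D δ u K : ℝ} {r : ℕ} (e : ι)
    (hm : ∀ e, mean (gibbsWeight c S t) (present {e}) = m) (hm0 : 0 ≤ m) (hm1 : m ≤ 1)
    (hκ : ∀ f g, f ≠ g → covar (gibbsWeight c S t) (present {f}) (present {g}) ≤ κ)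
    (hκ0 : 0 ≤ κ) (hr : ∀ j, #(S j) ≤ r) (hD : pairCoeff c S e e ≤ D)
    (hα : ∀ f, f ≠ e → pairCoeff c S e f ≤ α) (hα0 : 0 ≤ α)
    (hu : |∑ j with e ∈ S j, c j * m ^ (#(S j) - 1) - u| ≤ δ) (hu0 : 0 ≤ u) (huD : u ≤ D)
    (hK0 : 0 ≤ K) (hK : ∀ y, |y| ≤ D → |Real.exp y - 1 - y| ≤ K * y ^ 2) :
    |m - Phi (u + t e)| ≤ D * (r ^ 2 * κ) + δ + r * D * κ +
      K * (r * D * (α + r * D * κ) + (D * (r ^ 2 * κ) + δ) ^ 2) := by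
  set w := gibbsWeight c S t with hw_def
  have hw : ∀ x, 0 < w x := gibbsWeight_pos
  set h := localField c S e with hh
  set X : (ι → Bool) → ℝ := present {e} with hX
  have hA : ∑ f ∈ univ.erase e, pairCoeff c S e f ≤ r * D :=
    (sum_pairCoeff_erase_le hc hr e).trans (mul_le_mul_of_nonneg_left hD (Nat.cast_nonneg r))
  have hmean : |mean w h - u| ≤ D * (r ^ 2 * κ) + δ :=
    abs_mean_localField_sub_le hc e hm hm0 hm1 hκ hκ0 hr hD hu
  have hvar : covar w h h ≤ r * D * (α + r * D * κ) :=
    covar_localField_self_le hc e hκ hκ0 hα hα0 hA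
  have hXh0 : 0 ≤ covar w X h :=
    covar_gibbsWeight_nonneg hc (present_monotone _) (localField_monotone hc e)
  have hXh : covar w X h ≤ r * D * κ := by
    refine (covar_localField_le hc (present_monotone _) e).trans
      ((sum_le_sum fun f hf ↦ mul_le_mul_of_nonneg_left (hκ e f (ne_of_mem_erase hf).symm)
        (pairCoeff_nonneg hc e f)).trans ?_)
    rw [← sum_mul]
    exact mul_le_mul_of_nonneg_right hA hκ0
  set E := Real.exp (u + t e) with hE
  have hE0 : 0 < E := Real.exp_pos _
  set g : (ι → Bool) → ℝ := fun x ↦ (1 - X x) * (Real.exp (h x - u) - 1) with hg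
  set q : (ι → Bool) → ℝ :=
    fun x ↦ (1 - X x) * (Real.exp (h x - u) - 1 - (h x - u)) with hq
  have hmE : m = E * (1 - m + mean w g) := by
    have h1 : (fun x ↦ (1 - X x) * Real.exp (h x + t e)) =
        E • ((fun _ ↦ (1 : ℝ)) - X + g) := by
      ext x
      have : Real.exp (h x + t e) = E * Real.exp (h x - u) := by
        rw [hE, ← Real.exp_add]; ring_nf
      simp only [this, hg, Pi.smul_apply, Pi.add_apply, Pi.sub_apply, smul_eq_mul]
      ring
    calc m = mean w X := (hm e).symm
      _ = mean w fun x ↦ (1 - X x) * Real.exp (h x + t e) := mean_present_singleton_eq e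
      _ = _ := by rw [h1, map_smul, map_add, map_sub, mean_const hw, hm e, smul_eq_mul]
  have hgq : mean w g = (1 - m) * (mean w h - u) - covar w X h + mean w q := by
    have h1 : g = h - (fun _ ↦ u) - X * h + u • X + q := by
      ext x
      simp only [hg, hq, Pi.smul_apply, Pi.add_apply, Pi.sub_apply, Pi.mul_apply, smul_eq_mul]
      ring
    rw [h1, map_add, map_add, map_sub, map_sub, map_smul, mean_const hw, covar_apply, hm e,
      smul_eq_mul]
    ring
  have hqle : |mean w q| ≤
      K * (r * D * (α + r * D * κ) + (D * (r ^ 2 * κ) + δ) ^ 2) := by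
    have h1 : mean w |q| ≤ mean w (K • fun x ↦ (h x - u) ^ 2) := by
      refine mean_mono hw fun x ↦ ?_
      have hx0 := localField_nonneg (S := S) hc e x
      have hxD := (localField_le (S := S) hc e x).trans hD
      have hX0 := present_nonneg {e} x
      have hX1 := present_le_one {e} x
      simp only [hq, Pi.abs_apply, abs_mul, Pi.smul_apply, smul_eq_mul]
      refine (mul_le_of_le_one_left (abs_nonneg _) ?_).trans (hK _ ?_)
      · rw [abs_le]; constructor <;> linarith
      · rw [abs_le]; constructor <;> linarith
    rw [map_smul, mean_sub_const_sq hw, smul_eq_mul] at h1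
    refine (abs_mean_le hw q).trans (h1.trans (mul_le_mul_of_nonneg_left ?_ hK0))
    exact add_le_add hvar (sq_le_sq' (abs_le.1 hmean).1 (abs_le.1 hmean).2)
  have hgle : |mean w g| ≤ D * (r ^ 2 * κ) + δ + r * D * κ +
      K * (r * D * (α + r * D * κ) + (D * (r ^ 2 * κ) + δ) ^ 2) := by
    rw [hgq]
    refine (abs_add_le _ _).trans (add_le_add ((abs_sub _ _).trans (add_le_add ?_ ?_)) hqle)
    · rw [abs_mul, abs_of_nonneg (sub_nonneg.2 hm1)]
      exact (mul_le_of_le_one_left (abs_nonneg _) (by linarith)).trans hmean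
    · rwa [abs_of_nonneg hXh0]
  have hfinal : m - Phi (u + t e) = E / (1 + E) * mean w g := by
    rw [Phi, ← hE, eq_comm]
    field_simp
    linarith
  rw [hfinal, abs_mul, abs_of_nonneg (by positivity)]
  exact (mul_le_of_le_one_left (abs_nonneg _) (by rw [div_le_one (by positivity)]; linarith)).trans
    hgle

end LocalField

section EdgePerm

variable {n : ℕ}

/-- The permutation of the edges of `K_n` induced by a permutation of the vertices. -/
def edgePerm (σ : Equiv.Perm (Fin n)) : Equiv.Perm (EdgeSet n) where
  toFun e := ⟨e.1.map σ, by rw [Sym2.isDiag_map σ.injective]; exact e.2⟩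
  invFun e := ⟨e.1.map σ.symm, by rw [Sym2.isDiag_map σ.symm.injective]; exact e.2⟩
  left_inv e := Subtype.ext <| by simp [Sym2.map_map]
  right_inv e := Subtype.ext <| by simp [Sym2.map_map]

lemma edgePerm_val (σ : Equiv.Perm (Fin n)) (e : EdgeSet n) : (edgePerm σ e).1 = e.1.map σ := rfl

lemma exists_endpoints {k : ℕ} (i : Fin k → EdgeSet n)
    (hi : ∀ q q', q ≠ q' → ¬ ShareVertex (i q) (i q')) :
    ∃ f : Fin k × Bool → Fin n, Function.Injective f ∧
      ∀ r, (i r).1 = s(f (r, false), f (r, true)) := by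
  have hex : ∀ r, ∃ ab : Fin n × Fin n, (i r).1 = s(ab.1, ab.2) := fun r ↦
    Sym2.ind (f := fun z ↦ ∃ ab : Fin n × Fin n, z = s(ab.1, ab.2)) (fun a b ↦ ⟨(a, b), rfl⟩)
      (i r).1
  choose ab hab using hex
  refine ⟨fun rb ↦ bif rb.2 then (ab rb.1).2 else (ab rb.1).1, ?_, fun r ↦ hab r⟩
  have hne : ∀ r, (ab r).1 ≠ (ab r).2 := fun r h ↦ (i r).2 (by rw [hab r, h]; simp)
  have hmem : ∀ rb : Fin k × Bool, (bif rb.2 then (ab rb.1).2 else (ab rb.1).1) ∈ (i rb.1).1 := by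
    rintro ⟨r, b⟩
    rw [hab r]
    cases b <;> simp
  rintro ⟨r, b⟩ ⟨r', b'⟩ h
  have hr : r = r' := by
    by_contra hrr
    refine hi r r' hrr ⟨_, hmem (r, b), ?_⟩
    dsimp only at h ⊢
    rw [h]
    exact hmem (r', b')
  subst hr
  have := hne r
  cases b <;> cases b' <;> simp_all [eq_comm]

lemma exists_edgePerm_eq {k : ℕ} (i i' : Fin k → EdgeSet n)
    (hi : ∀ q q', q ≠ q' → ¬ ShareVertex (i q) (i q'))
    (hi' : ∀ q q', q ≠ q' → ¬ ShareVertex (i' q) (i' q')) :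
    ∃ σ : Equiv.Perm (Fin n), ∀ r, edgePerm σ (i r) = i' r := by
  obtain ⟨f, hf, hif⟩ := exists_endpoints i hi
  obtain ⟨f', hf', hif'⟩ := exists_endpoints i' hi'
  obtain ⟨σ, hσ⟩ := Equiv.Perm.exists_extending_pair f f' hf hf'
  exact ⟨σ, fun r ↦ Subtype.ext <| by simp [edgePerm_val, hif, hif', hσ]⟩

lemma exists_edgePerm_apply_eq (e e' : EdgeSet n) :
    ∃ σ : Equiv.Perm (Fin n), edgePerm σ e = e' := by
  obtain ⟨σ, hσ⟩ := exists_edgePerm_eq (k := 1) (fun _ ↦ e) (fun _ ↦ e')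
    (fun q q' h ↦ (h (Subsingleton.elim q q')).elim)
    (fun q q' h ↦ (h (Subsingleton.elim q q')).elim)
  exact ⟨σ, hσ 0⟩

lemma exists_eq_mk_notMem {e f : EdgeSet n} (hef : f ≠ e) :
    ∃ c d : Fin n, f.1 = s(c, d) ∧ d ∉ e.1 := by
  obtain ⟨f, hf⟩ := f
  obtain ⟨e, he⟩ := e
  induction f with | _ c d
  by_cases hd : d ∈ e
  · by_cases hc : c ∈ e
    · exact (hef (Subtype.ext ((Sym2.mem_and_mem_iff (by simpa using hf)).1 ⟨hc, hd⟩).symm)).elim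
    · exact ⟨d, c, Sym2.eq_swap, hc⟩
  · exact ⟨c, d, rfl, hd⟩

/-- A function of edges which is symmetric under the vertex permutations fixing `e` takes each of
its values away from `e` at least `n - 3` times. -/
lemma mul_le_of_symmetric {Q : EdgeSet n → ℝ} {e f : EdgeSet n} (hef : f ≠ e) {R : ℝ}
    (hQ : ∀ σ, edgePerm σ e = e → ∀ g, Q (edgePerm σ g) = Q g) (hQ0 : ∀ g, g ≠ e → 0 ≤ Q g)
    (hR : ∑ g ∈ univ.erase e, Q g ≤ R) : ((n : ℝ) - 3) * Q f ≤ R := by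
  obtain ⟨c, d, hf, hd⟩ := exists_eq_mk_notMem hef
  obtain ⟨a, b, he⟩ : ∃ a b, e.1 = s(a, b) :=
    Sym2.ind (f := fun z ↦ ∃ a b, z = s(a, b)) (fun a b ↦ ⟨a, b, rfl⟩) e.1
  have hcd : c ≠ d := fun h ↦ f.2 (by rw [hf, h]; simp)
  have hda : d ≠ a := fun h ↦ hd (by simp [he, h])
  have hdb : d ≠ b := fun h ↦ hd (by simp [he, h])
  have hT : (n : ℝ) - 3 ≤ #(univ \ {a, b, c} : Finset (Fin n)) := by
    have h1 := le_card_sdiff {a, b, c} (univ : Finset (Fin n))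
    have h2 : #({a, b, c} : Finset (Fin n)) ≤ 3 := card_le_three
    rw [card_univ, Fintype.card_fin] at h1
    have : n ≤ #(univ \ {a, b, c} : Finset (Fin n)) + 3 := by omega
    have : (n : ℝ) ≤ #(univ \ {a, b, c} : Finset (Fin n)) + 3 := by exact_mod_cast this
    linarith
  have hval : ∀ d' ∈ (univ \ {a, b, c} : Finset (Fin n)),
      (edgePerm (Equiv.swap d d') f).1 = s(c, d') := by
    intro d' hd'
    simp only [Finset.mem_sdiff, mem_univ, mem_insert, mem_singleton, not_or, true_and] at hd'
    rw [edgePerm_val, hf, Sym2.map_mk, Equiv.swap_apply_left,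
      Equiv.swap_apply_of_ne_of_ne hcd (Ne.symm hd'.2.2)]
  have hfix : ∀ d' ∈ (univ \ {a, b, c} : Finset (Fin n)), edgePerm (Equiv.swap d d') e = e := by
    intro d' hd'
    simp only [Finset.mem_sdiff, mem_univ, mem_insert, mem_singleton, not_or, true_and] at hd'
    apply Subtype.ext
    rw [edgePerm_val, he, Sym2.map_mk, Equiv.swap_apply_of_ne_of_ne hda.symm (Ne.symm hd'.1),
      Equiv.swap_apply_of_ne_of_ne hdb.symm (Ne.symm hd'.2.1)]
  have hinj : Set.InjOn (fun d' ↦ edgePerm (Equiv.swap d d') f)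
      (univ \ {a, b, c} : Finset (Fin n)) := by
    intro d₁ h₁ d₂ h₂ h
    have := congrArg Subtype.val h
    simp only [hval _ h₁, hval _ h₂] at this
    exact Sym2.congr_right.1 this
  calc ((n : ℝ) - 3) * Q f ≤ #(univ \ {a, b, c} : Finset (Fin n)) * Q f :=
        mul_le_mul_of_nonneg_right hT (hQ0 f hef)
    _ = ∑ d' ∈ (univ \ {a, b, c} : Finset (Fin n)), Q (edgePerm (Equiv.swap d d') f) := by
        rw [← nsmul_eq_mul, ← sum_const]
        exact sum_congr rfl fun d' hd' ↦ (hQ _ (hfix d' hd') f).symm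
    _ = ∑ g ∈ (univ \ {a, b, c} : Finset (Fin n)).image fun d' ↦ edgePerm (Equiv.swap d d') f,
        Q g := (sum_image hinj).symm
    _ ≤ ∑ g ∈ univ.erase e, Q g := by
        refine sum_le_sum_of_subset_of_nonneg (fun g hg ↦ ?_) fun g hg _ ↦
          hQ0 g (ne_of_mem_erase hg)
        obtain ⟨d', hd', rfl⟩ := mem_image.1 hg
        refine mem_erase.2 ⟨fun h ↦ hef ?_, mem_univ _⟩
        exact (edgePerm (Equiv.swap d d')).injective (h.trans (hfix d' hd').symm)
    _ ≤ R := hR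

end EdgePerm

section CopyEdges

variable {n m : ℕ}

open scoped Classical in
/-- The edges of `K_n` in the copy of `G` placed by `ψ`. -/
noncomputable def copyEdges (G : SimpleGraph (Fin m)) (ψ : Fin m ↪ Fin n) : Finset (EdgeSet n) :=
  {e | e.1 ∈ Sym2.map ψ '' G.edgeSet}

lemma mem_copyEdges {G : SimpleGraph (Fin m)} {ψ : Fin m ↪ Fin n} {e : EdgeSet n} :
    e ∈ copyEdges G ψ ↔ e.1 ∈ Sym2.map ψ '' G.edgeSet := by
  simp [copyEdges]

lemma card_copyEdges (G : SimpleGraph (Fin m)) (ψ : Fin m ↪ Fin n) :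
    #(copyEdges G ψ) = numEdges G := by
  have h : (Subtype.val '' (copyEdges G ψ : Set (EdgeSet n))) = Sym2.map ψ '' G.edgeSet := by
    ext z
    simp only [Set.mem_image, mem_coe, mem_copyEdges]
    constructor
    · rintro ⟨e, he, rfl⟩
      exact he
    · rintro ⟨g, hg, rfl⟩
      refine ⟨⟨g.map ψ, ?_⟩, ⟨g, hg, rfl⟩, rfl⟩
      rw [Sym2.isDiag_map ψ.injective]
      exact G.not_isDiag_of_mem_edgeSet hg
  rw [numEdges, ← Set.ncard_image_of_injective _ (Sym2.map.injective ψ.injective), ← h,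
    Set.ncard_image_of_injective _ Subtype.val_injective, Set.ncard_coe_finset]

lemma edgePerm_mem_copyEdges {G : SimpleGraph (Fin m)} {ψ : Fin m ↪ Fin n}
    {σ : Equiv.Perm (Fin n)} {e : EdgeSet n} :
    edgePerm σ e ∈ copyEdges G (Equiv.embeddingCongr (Equiv.refl _) σ ψ) ↔
      e ∈ copyEdges G ψ := by
  have h : (Equiv.embeddingCongr (Equiv.refl _) σ ψ : Fin m → Fin n) = σ ∘ ψ := rfl
  rw [mem_copyEdges, mem_copyEdges, edgePerm_val, h, Sym2.map_comp, Set.image_comp,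
    (Sym2.map.injective σ.injective).mem_set_image]

lemma prod_edgeInd_eq_present (G : SimpleGraph (Fin m)) (ψ : Fin m ↪ Fin n) (x : Config n) :
    (∏ a : Fin m, ∏ b : Fin m,
      open scoped Classical in if G.Adj a b then edgeInd x (ψ a) (ψ b) else 1) =
      present (copyEdges G ψ) x := by
  classical
  have hval : ∀ a b, G.Adj a b → ∃ e : EdgeSet n, e.1 = s(ψ a, ψ b) ∧ e ∈ copyEdges G ψ ∧
      edgeInd x (ψ a) (ψ b) = if x e = true then 1 else 0 := by
    intro a b hab
    have hd : ¬ (s(ψ a, ψ b) : Sym2 (Fin n)).IsDiag := by simpa using hab.ne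
    refine ⟨⟨s(ψ a, ψ b), hd⟩, rfl, mem_copyEdges.2 ⟨s(a, b), hab, rfl⟩, ?_⟩
    rw [edgeInd, edgeVal, dif_neg hd]
  by_cases hx : ∀ e ∈ copyEdges G ψ, x e = true
  · rw [present_of_forall hx]
    refine prod_eq_one fun a _ ↦ prod_eq_one fun b _ ↦ ?_
    split_ifs with hab
    · obtain ⟨e, -, he, h⟩ := hval a b hab
      rw [h, if_pos (hx e he)]
    · rfl
  · rw [present_of_not_forall hx]
    push Not at hx
    obtain ⟨e, he, hxe⟩ := hx
    obtain ⟨g, hg, hge⟩ := mem_copyEdges.1 he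
    induction g with | _ a b
    have hab : G.Adj a b := hg
    refine prod_eq_zero (mem_univ a) (prod_eq_zero (mem_univ b) ?_)
    obtain ⟨e', he', -, h⟩ := hval a b hab
    obtain rfl : e' = e := Subtype.ext (he'.trans hge)
    rw [if_pos hab, h, if_neg hxe]

/-- Each edge of `K_n` lies in the same number of copies of `G`. -/
lemma choose_mul_card_filter_mem_copyEdges (G : SimpleGraph (Fin m)) (e : EdgeSet n) :
    n.choose 2 * #{ψ : Fin m ↪ Fin n | e ∈ copyEdges G ψ} =
      numEdges G * n.descFactorial m := by
  have hconst : ∀ f : EdgeSet n, #{ψ : Fin m ↪ Fin n | f ∈ copyEdges G ψ} =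
      #{ψ : Fin m ↪ Fin n | e ∈ copyEdges G ψ} := by
    intro f
    obtain ⟨σ, rfl⟩ := exists_edgePerm_apply_eq f e
    refine card_equiv (Equiv.embeddingCongr (Equiv.refl _) σ) fun ψ ↦ ?_
    simp only [mem_filter, mem_univ, true_and, edgePerm_mem_copyEdges]
  have hcard : Fintype.card (EdgeSet n) = n.choose 2 := by
    rw [Sym2.card_subtype_not_diag, Fintype.card_fin]
  have h1 : ∑ f : EdgeSet n, #{ψ : Fin m ↪ Fin n | f ∈ copyEdges G ψ} =
      ∑ ψ : Fin m ↪ Fin n, #(copyEdges G ψ) := by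
    simp only [card_filter]
    rw [sum_comm]
    simp
  simp only [hconst, card_copyEdges, sum_const, card_univ, smul_eq_mul, hcard,
    Fintype.card_embedding_eq, Fintype.card_fin] at h1
  rw [h1, mul_comm]

lemma card_filter_mem_copyEdges_eq_zero {G : SimpleGraph (Fin m)} (hG : numEdges G = 0)
    (e : EdgeSet n) : #{ψ : Fin m ↪ Fin n | e ∈ copyEdges G ψ} = 0 := by
  refine card_eq_zero.2 (filter_eq_empty_iff.2 fun ψ _ h ↦ ?_)
  have := card_pos.2 ⟨e, h⟩
  rw [card_copyEdges] at this
  omega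

lemma two_le_of_numEdges_pos {G : SimpleGraph (Fin m)} (hG : 0 < numEdges G) : 2 ≤ m := by
  obtain ⟨g, hg⟩ := Set.nonempty_of_ncard_ne_zero hG.ne'
  induction g with | _ a b
  have hab : G.Adj a b := hg
  have := Fintype.one_lt_card_iff.2 ⟨a, b, hab.ne⟩
  rwa [Fintype.card_fin] at this

lemma card_filter_mem_copyEdges (hn : 2 ≤ n) (hm : 2 ≤ m) (G : SimpleGraph (Fin m))
    (e : EdgeSet n) :
    #{ψ : Fin m ↪ Fin n | e ∈ copyEdges G ψ} =
      2 * numEdges G * (n - 2).descFactorial (m - 2) := by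
  have h := choose_mul_card_filter_mem_copyEdges G e
  have hc : n.choose 2 * 2 = n * (n - 1) := by
    rw [Nat.choose_two_right, Nat.div_mul_cancel (Nat.even_mul_pred_self n).two_dvd]
  obtain ⟨m, rfl⟩ := Nat.exists_eq_add_of_le' hm
  obtain ⟨n, rfl⟩ := Nat.exists_eq_add_of_le' hn
  have hd : (n + 2).descFactorial (m + 2) = (n + 2) * (n + 1) * n.descFactorial m := by
    rw [Nat.succ_descFactorial_succ, Nat.succ_descFactorial_succ, mul_assoc]
  have hpos : 0 < (n + 2) * (n + 1) := by positivity
  refine Nat.eq_of_mul_eq_mul_left hpos ?_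
  simp only [Nat.add_sub_cancel, Nat.add_succ_sub_one] at hc ⊢
  rw [← hc, mul_right_comm, h, hd]
  rw [hd] at h
  rw [hc]
  ring

/-- The normalised number of copies of `G` through an edge is `2 * numEdges G`, up to `O(1 / n)`. -/
lemma card_filter_mem_copyEdges_div_bounds (hn : 2 ≤ n) (hmn : m ≤ n)
    (G : SimpleGraph (Fin m)) (e : EdgeSet n) :
    (#{ψ : Fin m ↪ Fin n | e ∈ copyEdges G ψ} : ℝ) / (n : ℝ) ^ (m - 2) ≤ 2 * numEdges G ∧
      2 * numEdges G - 2 * numEdges G * (m : ℝ) ^ 2 / n ≤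
        (#{ψ : Fin m ↪ Fin n | e ∈ copyEdges G ψ} : ℝ) / (n : ℝ) ^ (m - 2) := by
  rcases Nat.eq_zero_or_pos (numEdges G) with h0 | hpos
  · simp [h0, card_filter_mem_copyEdges_eq_zero h0]
  have hm := two_le_of_numEdges_pos hpos
  rw [card_filter_mem_copyEdges hn hm]
  have hn0 : (0 : ℝ) < n := by positivity
  have hnp : (0 : ℝ) < (n : ℝ) ^ (m - 2) := by positivity
  have hE : (0 : ℝ) ≤ 2 * numEdges G := by positivity
  push_cast
  constructor
  · rw [div_le_iff₀ hnp]
    refine mul_le_mul_of_nonneg_left ?_ hE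
    have : (n - 2).descFactorial (m - 2) ≤ n ^ (m - 2) :=
      (Nat.descFactorial_le_pow _ _).trans (Nat.pow_le_pow_left (Nat.sub_le n 2) _)
    exact_mod_cast this
  · have h1 : (n - m) ^ (m - 2) ≤ (n - 2).descFactorial (m - 2) :=
      le_trans (Nat.pow_le_pow_left (by omega) _) (Nat.pow_sub_le_descFactorial _ _)
    have h2 : ((n : ℝ) - m) ^ (m - 2) ≤ (n - 2).descFactorial (m - 2) := by
      rw [← Nat.cast_sub hmn]
      exact_mod_cast h1
    have hb : 1 + ((m - 2 : ℕ) : ℝ) * (-(m : ℝ) / n) ≤ (1 + -(m : ℝ) / n) ^ (m - 2) := by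
      refine one_add_mul_le_pow ?_ _
      have : (m : ℝ) / n ≤ 1 := by rw [div_le_one hn0]; exact_mod_cast hmn
      rw [neg_div]; linarith
    have h3 : (1 + -(m : ℝ) / n) ^ (m - 2) = ((n : ℝ) - m) ^ (m - 2) / (n : ℝ) ^ (m - 2) := by
      rw [← div_pow]; congr 1; field_simp; ring
    rw [h3] at hb
    have h4 : 1 - (m : ℝ) ^ 2 / n ≤ 1 + ((m - 2 : ℕ) : ℝ) * (-(m : ℝ) / n) := by
      have : ((m - 2 : ℕ) : ℝ) ≤ m := by exact_mod_cast Nat.sub_le m 2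
      have h5 : ((m - 2 : ℕ) : ℝ) * (m / n) ≤ m * (m / n) := by gcongr
      rw [sq, mul_div_assoc, neg_div]
      linarith
    have h5 : ((n : ℝ) - m) ^ (m - 2) / (n : ℝ) ^ (m - 2) ≤
        ((n - 2).descFactorial (m - 2) : ℝ) / (n : ℝ) ^ (m - 2) := by gcongr
    have := mul_le_mul_of_nonneg_left (h4.trans (hb.trans h5)) hE
    calc _ = 2 * (numEdges G : ℝ) * (1 - (m : ℝ) ^ 2 / n) := by ring
      _ ≤ _ := this
      _ = _ := by ring

end CopyEdges

section ErgmWeight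

lemma present_comp_equiv {ι : Type*} {S S' : Finset ι} (τ : Equiv.Perm ι)
    (h : ∀ e, τ e ∈ S' ↔ e ∈ S) (x : ι → Bool) : present S (x ∘ τ) = present S' x := by
  have : (∀ e ∈ S, (x ∘ τ) e = true) ↔ ∀ e ∈ S', x e = true := by
    rw [← τ.forall_congr_right (q := fun e ↦ e ∈ S' → x e = true)]
    simp only [h, Function.comp_apply]
  simp only [present, this]

lemma edgeX_eq_present {n : ℕ} (e : EdgeSet n) : edgeX e = present {e} := by
  ext x
  simp [edgeX, present]

variable {n s : ℕ} (V : Fin s → ℕ) (G : ∀ i, SimpleGraph (Fin (V i))) (β : Fin s → ℝ)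

/-- The coefficient in the Hamiltonian of a labelled copy of one of the graphs `G i`. -/
noncomputable def copyCoeff (j : Σ i, Fin (V i) ↪ Fin n) : ℝ := β j.1 / (n : ℝ) ^ (V j.1 - 2)

/-- The edges of a labelled copy of one of the graphs `G i`. -/
noncomputable def copySet (j : Σ i, Fin (V i) ↪ Fin n) : Finset (EdgeSet n) :=
  copyEdges (G j.1) j.2

/-- The unnormalised ERGM weight, with an additional external field `t` on every edge. -/
noncomputable def ergmWeight (t : ℝ) : Config n → ℝ :=
  gibbsWeight (copyCoeff V β) (copySet V G) fun _ ↦ t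

variable {V G β}

lemma copyCoeff_nonneg (hβ : ∀ i, 0 < β i) (j : Σ i, Fin (V i) ↪ Fin n) :
    0 ≤ copyCoeff V β j := div_nonneg (hβ _).le (by positivity)

lemma ergmWeight_pos (t : ℝ) (x : Config n) : 0 < ergmWeight V G β t x := gibbsWeight_pos x

lemma ergmWeight_zero (x : Config n) :
    ergmWeight V G β 0 x = Real.exp (Hamiltonian V G β x) := by
  simp only [ergmWeight, gibbsWeight, zero_mul, sum_const_zero, add_zero, Hamiltonian, NG,
    prod_edgeInd_eq_present, Fintype.sum_sigma, copyCoeff, copySet, mul_sum, sum_div]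
  congr! 3
  ring

lemma expect_ergmProb (f : Config n → ℝ) :
    expect (ergmProb V G β) f = mean (ergmWeight V G β 0) f := by
  simp only [expect, ergmProb, mean_apply, ergmWeight_zero, sum_div]
  exact sum_congr rfl fun x _ ↦ by ring

/-- Relabelling the edges of a configuration by a permutation of the vertices. -/
def permConfig (σ : Equiv.Perm (Fin n)) : Config n ≃ Config n :=
  (edgePerm σ).symm.arrowCongr (Equiv.refl Bool)

lemma permConfig_apply (σ : Equiv.Perm (Fin n)) (x : Config n) :
    permConfig σ x = x ∘ edgePerm σ := rfl

/-- The action of a permutation of the vertices on labelled copies. -/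
def permCopy (σ : Equiv.Perm (Fin n)) : Equiv.Perm (Σ i, Fin (V i) ↪ Fin n) :=
  Equiv.sigmaCongrRight fun _ ↦ Equiv.embeddingCongr (Equiv.refl _) σ

lemma edgePerm_mem_copySet {σ : Equiv.Perm (Fin n)} {e : EdgeSet n}
    (j : Σ i, Fin (V i) ↪ Fin n) :
    edgePerm σ e ∈ copySet V G (permCopy σ j) ↔ e ∈ copySet V G j := edgePerm_mem_copyEdges

lemma copyCoeff_permCopy (σ : Equiv.Perm (Fin n)) (j : Σ i, Fin (V i) ↪ Fin n) :
    copyCoeff V β (permCopy σ j) = copyCoeff V β j := rfl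

lemma ergmWeight_permConfig (t : ℝ) (σ : Equiv.Perm (Fin n)) (x : Config n) :
    ergmWeight V G β t (permConfig σ x) = ergmWeight V G β t x := by
  simp only [ergmWeight, gibbsWeight, permConfig_apply]
  congr 2
  · rw [← Equiv.sum_comp (permCopy σ) fun j ↦ copyCoeff V β j * present (copySet V G j) x]
    exact sum_congr rfl fun j _ ↦ by
      rw [copyCoeff_permCopy, present_comp_equiv (edgePerm σ) fun e ↦ edgePerm_mem_copySet j]
  · rw [← Equiv.sum_comp (edgePerm σ) fun e ↦ t * present {e} x]
    exact sum_congr rfl fun e _ ↦ by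
      rw [present_comp_equiv (S' := {edgePerm σ e}) (edgePerm σ) (by simp)]

lemma present_singleton_comp_permConfig (σ : Equiv.Perm (Fin n)) (e : EdgeSet n) :
    present {e} ∘ permConfig σ = present {edgePerm σ e} := by
  ext x
  exact present_comp_equiv _ (by simp) x

lemma mean_present_edgePerm (t : ℝ) (σ : Equiv.Perm (Fin n)) (e : EdgeSet n) :
    mean (ergmWeight V G β t) (present {edgePerm σ e}) =
      mean (ergmWeight V G β t) (present {e}) := by
  rw [← present_singleton_comp_permConfig, mean_comp_equiv _ (ergmWeight_permConfig t σ)]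

lemma mean_present_eq (t : ℝ) (e e' : EdgeSet n) :
    mean (ergmWeight V G β t) (present {e}) = mean (ergmWeight V G β t) (present {e'}) := by
  obtain ⟨σ, rfl⟩ := exists_edgePerm_apply_eq e' e
  exact mean_present_edgePerm t σ e'

lemma covar_present_edgePerm (t : ℝ) (σ : Equiv.Perm (Fin n)) (e f : EdgeSet n) :
    covar (ergmWeight V G β t) (present {edgePerm σ e}) (present {edgePerm σ f}) =
      covar (ergmWeight V G β t) (present {e}) (present {f}) := by
  rw [← present_singleton_comp_permConfig, ← present_singleton_comp_permConfig,
    covar_comp_equiv _ (ergmWeight_permConfig t σ)]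

lemma pairCoeff_edgePerm (σ : Equiv.Perm (Fin n)) (e f : EdgeSet n) :
    pairCoeff (copyCoeff V β) (copySet V G) (edgePerm σ e) (edgePerm σ f) =
      pairCoeff (copyCoeff V β) (copySet V G) e f := by
  simp only [pairCoeff, sum_filter]
  rw [← Equiv.sum_comp (permCopy σ)]
  simp only [edgePerm_mem_copySet, copyCoeff_permCopy]

lemma sum_copyCoeff_filter_mem (a : ℕ → ℝ) (e : EdgeSet n) :
    ∑ j with e ∈ copySet V G j, copyCoeff V β j * a #(copySet V G j) =
      ∑ i, β i * ((#{ψ : Fin (V i) ↪ Fin n | e ∈ copyEdges (G i) ψ} : ℝ) /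
        (n : ℝ) ^ (V i - 2)) * a (numEdges (G i)) := by
  rw [sum_filter, Fintype.sum_sigma]
  refine sum_congr rfl fun i _ ↦ ?_
  simp only [copySet, copyCoeff, card_copyEdges]
  rw [← sum_filter, sum_const, nsmul_eq_mul]
  ring

/-- The total number of edges of the graphs `G i`. -/
noncomputable def totalEdges (G : ∀ i, SimpleGraph (Fin (V i))) : ℕ := ∑ i, numEdges (G i)

lemma card_copySet_le (j : Σ i, Fin (V i) ↪ Fin n) : #(copySet V G j) ≤ totalEdges G := by
  rw [copySet, card_copyEdges]
  exact single_le_sum (f := fun i ↦ numEdges (G i)) (fun _ _ ↦ Nat.zero_le _) (mem_univ j.1)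

lemma pairCoeff_copy_self_le (hβ : ∀ i, 0 < β i) (hn : 2 ≤ n) (hV : ∀ i, V i ≤ n)
    (e : EdgeSet n) : pairCoeff (copyCoeff V β) (copySet V G) e e ≤ Psi V G β 1 := by
  have h := sum_copyCoeff_filter_mem (V := V) (G := G) (β := β) (fun _ ↦ 1) e
  simp only [mul_one] at h
  rw [pairCoeff_self, h, Psi]
  refine sum_le_sum fun i _ ↦ ?_
  have := mul_le_mul_of_nonneg_left
    (card_filter_mem_copyEdges_div_bounds hn (hV i) (G i) e).1 (hβ i).le
  rw [one_pow]
  linarith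

/-- A bound for the rate at which the mean local field approaches `Psi`. -/
noncomputable def psiRate (V : Fin s → ℕ) (G : ∀ i, SimpleGraph (Fin (V i))) (β : Fin s → ℝ) : ℝ :=
  ∑ i, 2 * β i * numEdges (G i) * (V i : ℝ) ^ 2

lemma abs_sum_copyCoeff_sub_Psi_le (hβ : ∀ i, 0 < β i) (hn : 2 ≤ n) (hV : ∀ i, V i ≤ n)
    (e : EdgeSet n) {m : ℝ} (hm0 : 0 ≤ m) (hm1 : m ≤ 1) :
    |∑ j with e ∈ copySet V G j, copyCoeff V β j * m ^ (#(copySet V G j) - 1) - Psi V G β m| ≤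
      psiRate V G β / n := by
  rw [sum_copyCoeff_filter_mem (fun l ↦ m ^ (l - 1)), Psi, ← sum_sub_distrib, psiRate, sum_div]
  refine (abs_sum_le_sum_abs _ _).trans (sum_le_sum fun i _ ↦ ?_)
  obtain ⟨h1, h2⟩ := card_filter_mem_copyEdges_div_bounds hn (hV i) (G i) e
  set q := (#{ψ : Fin (V i) ↪ Fin n | e ∈ copyEdges (G i) ψ} : ℝ) / (n : ℝ) ^ (V i - 2)
  have hpow0 : 0 ≤ m ^ (numEdges (G i) - 1) := by positivity
  have hpow1 : m ^ (numEdges (G i) - 1) ≤ 1 := pow_le_one₀ hm0 hm1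
  have habs : |q - 2 * numEdges (G i)| ≤ 2 * numEdges (G i) * (V i : ℝ) ^ 2 / n := by
    rw [abs_le]
    constructor
    · linarith
    · have : 0 ≤ 2 * numEdges (G i) * (V i : ℝ) ^ 2 / n := by positivity
      linarith
  calc |β i * q * m ^ (numEdges (G i) - 1) - 2 * β i * numEdges (G i) * m ^ (numEdges (G i) - 1)|
      = β i * |q - 2 * numEdges (G i)| * m ^ (numEdges (G i) - 1) := by
        rw [← abs_of_pos (hβ i), ← abs_of_nonneg hpow0, ← abs_mul, ← abs_mul,
          abs_of_pos (hβ i), abs_of_nonneg hpow0]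
        ring_nf
    _ ≤ β i * (2 * numEdges (G i) * (V i : ℝ) ^ 2 / n) * 1 := by
        have := (hβ i).le
        gcongr
    _ = _ := by ring

lemma Psi_nonneg (hβ : ∀ i, 0 < β i) {m : ℝ} (hm0 : 0 ≤ m) : 0 ≤ Psi V G β m :=
  sum_nonneg fun i _ ↦ by have := (hβ i).le; positivity

lemma Psi_le_Psi_one (hβ : ∀ i, 0 < β i) {m : ℝ} (hm0 : 0 ≤ m) (hm1 : m ≤ 1) :
    Psi V G β m ≤ Psi V G β 1 :=
  sum_le_sum fun i _ ↦ by have := (hβ i).le; gcongr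

end ErgmWeight

section Analysis

lemma exists_abs_exp_sub_one_sub_le (D : ℝ) :
    ∃ K : ℝ, 0 ≤ K ∧ ∀ y, |y| ≤ D → |Real.exp y - 1 - y| ≤ K * y ^ 2 := by
  refine ⟨Real.exp D + 1 + |D|, by positivity, fun y hy ↦ ?_⟩
  have hexp : Real.exp y ≤ Real.exp D := Real.exp_le_exp.2 ((le_abs_self y).trans hy)
  have hpos := Real.exp_pos y
  have hD : |y| ≤ |D| := hy.trans (le_abs_self D)
  rcases le_or_gt |y| 1 with h | h
  · refine (Real.abs_exp_sub_one_sub_id_le h).trans (le_mul_of_one_le_left (sq_nonneg y) ?_)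
    have := abs_nonneg D
    have := Real.exp_pos D
    linarith
  · have h1 : |Real.exp y - 1 - y| ≤ Real.exp D + 1 + |D| := by
      rw [abs_le]
      constructor <;> linarith [neg_abs_le y, le_abs_self y]
    exact h1.trans (le_mul_of_one_le_right (by positivity) ((one_lt_sq_iff_one_lt_abs y).2 h).le)

lemma Phi_eq_sigmoid : Phi = Real.sigmoid := by
  ext u
  have := Real.exp_pos u
  rw [Phi, Real.sigmoid_def, Real.exp_neg]
  field_simp
  ring

lemma abs_Phi_sub_le (u v : ℝ) : |Phi u - Phi v| ≤ |u - v| := by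
  have h := Convex.norm_image_sub_le_of_norm_deriv_le (f := Real.sigmoid) (C := 1)
    (fun x _ ↦ differentiableAt_sigmoid) (fun x _ ↦ ?_) convex_univ
    (Set.mem_univ v) (Set.mem_univ u)
  · simpa [Phi_eq_sigmoid] using h
  · have h0 := Real.sigmoid_pos x
    have h1 := Real.sigmoid_lt_one x
    rw [Real.deriv_sigmoid, Real.norm_eq_abs, abs_le]
    constructor <;> nlinarith

/-- Approximate solutions of a nondegenerate, uniquely solvable fixed-point equation are close to
the solution. -/
lemma exists_mul_abs_sub_le_of_unique_fixedPoint {f : ℝ → ℝ} (hf : Differentiable ℝ f) {p : ℝ}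
    (hp : f p = p) (huniq : ∀ q, f q = q → q = p) (hderiv : deriv f p ≠ 1) {A : Set ℝ}
    (hA : IsCompact A) : ∃ c > 0, ∀ q ∈ A, c * |q - p| ≤ |f q - q| := by
  set g : ℝ → ℝ := fun q ↦ f q - q with hg
  have hgd : Differentiable ℝ g := hf.sub differentiable_id
  have hcont : Continuous (dslope g p) := by
    rw [← continuousOn_univ, continuousOn_dslope univ_mem]
    exact ⟨hgd.continuous.continuousOn, hgd p⟩
  have hsub (q : ℝ) : (q - p) * dslope g p q = f q - q := by
    have := sub_smul_dslope g p q
    simpa [hg, hp] using this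
  have hne (q : ℝ) : dslope g p q ≠ 0 := by
    rcases eq_or_ne q p with rfl | hq
    · rw [dslope_same, hg, deriv_fun_sub (hf q) differentiableAt_fun_id, deriv_id'']
      exact sub_ne_zero.2 hderiv
    · intro h
      refine hq (huniq q ?_)
      have := hsub q
      rw [h, mul_zero] at this
      linarith
  rcases A.eq_empty_or_nonempty with rfl | hAne
  · exact ⟨1, one_pos, by simp⟩
  obtain ⟨q₀, -, hq₀⟩ := hA.exists_isMinOn hAne hcont.abs.continuousOn
  refine ⟨|dslope g p q₀|, abs_pos.2 (hne q₀), fun q hq ↦ ?_⟩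
  rw [← hsub q, abs_mul, mul_comm]
  exact mul_le_mul_of_nonneg_left (hq₀ hq) (abs_nonneg _)

lemma differentiable_phiFn {s : ℕ} (V : Fin s → ℕ) (G : ∀ i, SimpleGraph (Fin (V i)))
    (β : Fin s → ℝ) : Differentiable ℝ (phiFn V G β) := by
  have h : Differentiable ℝ (Psi V G β) := by
    unfold Psi
    fun_prop
  unfold phiFn
  rw [Phi_eq_sigmoid]
  exact h.sigmoid

lemma hasDerivAt_mean_gibbsWeight {ι J : Type*} [Fintype J] [Fintype ι] [DecidableEq ι]
    (c : J → ℝ) (S : J → Finset ι) (f : (ι → Bool) → ℝ) (t : ℝ) :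
    HasDerivAt (fun t ↦ mean (gibbsWeight c S fun _ ↦ t) f)
      (covar (gibbsWeight c S fun _ ↦ t) f (∑ e, present {e})) t := by
  have hw (x : ι → Bool) : HasDerivAt (fun t ↦ gibbsWeight c S (fun _ ↦ t) x)
      (gibbsWeight c S (fun _ ↦ t) x * (∑ e, present {e}) x) t := by
    simp only [gibbsWeight, ← mul_sum, Finset.sum_apply]
    exact (((hasDerivAt_id t).mul_const _).const_add _ |>.exp).congr_deriv (by simp)
  have hZ : ∑ x, gibbsWeight c S (fun _ ↦ t) x ≠ 0 :=
    (sum_pos_of_weight_pos gibbsWeight_pos).ne'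
  have h := (HasDerivAt.fun_sum (u := univ) fun x _ ↦ (hw x).mul_const (f x)).fun_div
    (HasDerivAt.fun_sum (u := univ) fun x _ ↦ hw x) hZ
  refine h.congr_deriv ?_
  rw [covar_apply, mean_apply, mean_apply, mean_apply]
  have hcomm : ∑ x, gibbsWeight c S (fun _ ↦ t) x * (f * ∑ e : ι, present {e} : (ι → Bool) → ℝ) x =
      ∑ x, gibbsWeight c S (fun _ ↦ t) x * (∑ e, present {e}) x * f x :=
    sum_congr rfl fun x _ ↦ by rw [Pi.mul_apply]; ring
  rw [hcomm]
  field_simp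

end Analysis

section Marginal

variable {n s : ℕ} {V : Fin s → ℕ} {G : ∀ i, SimpleGraph (Fin (V i))} {β : Fin s → ℝ} {p : ℝ}

lemma ergmWeight_covar_nonneg (hβ : ∀ i, 0 < β i) (t : ℝ) (e f : EdgeSet n) :
    0 ≤ covar (ergmWeight V G β t) (present {e}) (present {f}) :=
  covar_gibbsWeight_nonneg (copyCoeff_nonneg hβ) (present_monotone _) (present_monotone _)

lemma covar_sum_present_eq (t : ℝ) (e e' : EdgeSet n) :
    covar (ergmWeight V G β t) (present {e}) (∑ f, present {f}) =
      covar (ergmWeight V G β t) (present {e'}) (∑ f, present {f}) := by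
  obtain ⟨σ, rfl⟩ := exists_edgePerm_apply_eq e' e
  simp only [map_sum]
  rw [← Equiv.sum_comp (edgePerm σ)]
  simp only [covar_present_edgePerm]

lemma le_two_mul_div_of_sub_three_mul_le (hn : 6 ≤ n) {Q R : ℝ} (hQ : 0 ≤ Q)
    (h : ((n : ℝ) - 3) * Q ≤ R) : Q ≤ 2 * R / n := by
  have hn' : (6 : ℝ) ≤ n := by exact_mod_cast hn
  rw [le_div_iff₀ (by linarith)]
  nlinarith

/-- If the susceptibility at field `t` is small, the edge density is close to the fixed point. -/
lemma exists_abs_marginal_sub_le_of_covar_le (hβ : ∀ i, 0 < β i) (hsub : Subcritical V G β p) :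
    ∃ C : ℝ, 0 ≤ C ∧ ∃ N : ℕ, 0 < N ∧ ∀ n : ℕ, N ≤ n → ∀ (e : EdgeSet n) (t : ℝ),
      |t| ≤ 2 * (√n)⁻¹ →
      covar (ergmWeight V G β t) (present {e}) (∑ f, present {f}) ≤ √n →
      |mean (ergmWeight V G β t) (present {e}) - p| ≤ C * (√n)⁻¹ := by
  obtain ⟨hp, huniq, hderiv⟩ := hsub
  obtain ⟨c, hc, hstab⟩ := exists_mul_abs_sub_le_of_unique_fixedPoint
    (differentiable_phiFn V G β) hp huniq hderiv.ne (isCompact_Icc (a := (0 : ℝ)) (b := 1))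
  set D := Psi V G β 1 with hD
  set B := psiRate V G β with hB
  set r := totalEdges G with hr
  have hD0 : 0 ≤ D := Psi_nonneg hβ zero_le_one
  have hB0 : 0 ≤ B := sum_nonneg fun i _ ↦ by have := (hβ i).le; positivity
  obtain ⟨K, hK0, hK⟩ := exists_abs_exp_sub_one_sub_le D
  set L := 2 * D * r ^ 2 + B with hL
  have hL0 : 0 ≤ L := by positivity
  refine ⟨(L + 2 * r * D + K * (4 * r ^ 2 * D ^ 2 + L ^ 2) + 2) / c, by positivity,
    6 + ∑ i, V i, by omega, fun n hn e t ht hcov ↦ ?_⟩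
  have hn6 : 6 ≤ n := by omega
  have hV (i : Fin s) : V i ≤ n := by
    have := single_le_sum (f := V) (fun _ _ ↦ Nat.zero_le _) (mem_univ i)
    omega
  have hn0 : (0 : ℝ) < n := by positivity
  have hs0 : 0 < √(n : ℝ) := Real.sqrt_pos.2 hn0
  have hs1 : 1 ≤ √(n : ℝ) := Real.one_le_sqrt.2 (by exact_mod_cast (by omega : 1 ≤ n))
  set a := (√(n : ℝ))⁻¹ with ha
  have ha0 : 0 < a := inv_pos.2 hs0
  have ha1 : a ≤ 1 := inv_le_one_of_one_le₀ hs1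
  have haa : a * a ≤ a := mul_le_of_le_one_left ha0.le ha1
  have hna : (n : ℝ)⁻¹ = a * a := by rw [ha, ← mul_inv, Real.mul_self_sqrt hn0.le]
  have hsa : √(n : ℝ) / n = a := by rw [ha, Real.sqrt_div_self]
  set w := ergmWeight V G β (n := n) t with hw
  set m := mean w (present {e}) with hm
  have hm0 : 0 ≤ m := mean_nonneg (ergmWeight_pos t) fun x ↦ present_nonneg _ x
  have hm1 : m ≤ 1 := by
    rw [← mean_const (ergmWeight_pos (V := V) (G := G) (β := β) (n := n) t) 1]
    exact mean_mono (ergmWeight_pos t) fun x ↦ present_le_one _ x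
  have hκ (f g : EdgeSet n) (hfg : f ≠ g) : covar w (present {f}) (present {g}) ≤ 2 * a := by
    rw [← hsa, ← mul_div_assoc]
    refine le_two_mul_div_of_sub_three_mul_le hn6 (ergmWeight_covar_nonneg hβ t f g) ?_
    refine mul_le_of_symmetric (Q := fun g ↦ covar w (present {f}) (present {g})) hfg.symm
      (fun σ hσ g ↦ ?_) (fun g _ ↦ ergmWeight_covar_nonneg hβ t f g) ?_
    · rw [← covar_present_edgePerm t σ f g, hσ]
    · rw [covar_sum_present_eq t e f, map_sum] at hcov
      exact (sum_le_sum_of_subset_of_nonneg (erase_subset _ _)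
        fun g _ _ ↦ ergmWeight_covar_nonneg hβ t f g).trans hcov
  have hDe : pairCoeff (copyCoeff V β) (copySet V G) e e ≤ D :=
    pairCoeff_copy_self_le hβ (by omega) hV e
  have hα (f : EdgeSet n) (hf : f ≠ e) :
      pairCoeff (copyCoeff V β) (copySet V G) e f ≤ 2 * (r * D) * a := by
    have h0 (g : EdgeSet n) : 0 ≤ pairCoeff (copyCoeff V β) (copySet V G) e g :=
      pairCoeff_nonneg (copyCoeff_nonneg hβ) e g
    have h := le_two_mul_div_of_sub_three_mul_le hn6 (h0 f) <|
      mul_le_of_symmetric (Q := fun g ↦ pairCoeff (copyCoeff V β) (copySet V G) e g) hf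
        (R := r * D) (fun σ hσ g ↦ ?_) (fun g _ ↦ h0 g) ?_
    · refine h.trans ?_
      rw [div_eq_mul_inv, hna]
      gcongr
    · nth_rw 1 [← hσ]
      exact pairCoeff_edgePerm σ e g
    · exact (sum_pairCoeff_erase_le (copyCoeff_nonneg hβ) card_copySet_le e).trans
        (mul_le_mul_of_nonneg_left hDe (Nat.cast_nonneg r))
  have hu : |∑ j with e ∈ copySet V G j, copyCoeff V β j * m ^ (#(copySet V G j) - 1) -
      Psi V G β m| ≤ B * a := by
    refine (abs_sum_copyCoeff_sub_Psi_le hβ (by omega) hV e hm0 hm1).trans ?_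
    rw [div_eq_mul_inv, hna]
    gcongr
  have hmain := abs_marginal_sub_Phi_le (copyCoeff_nonneg hβ) e (fun f ↦ mean_present_eq t f e)
    hm0 hm1 hκ (by positivity) card_copySet_le hDe hα (by positivity) hu (Psi_nonneg hβ hm0)
    (Psi_le_Psi_one hβ hm0 hm1) hK0 hK
  have hlip : |Phi (Psi V G β m + t) - Phi (Psi V G β m)| ≤ 2 * a :=
    (abs_Phi_sub_le _ _).trans (by simpa using ht)
  have herr : D * (r ^ 2 * (2 * a)) + B * a + r * D * (2 * a) +
      K * (r * D * (2 * (r * D) * a + r * D * (2 * a)) + (D * (r ^ 2 * (2 * a)) + B * a) ^ 2) ≤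
      (L + 2 * r * D + K * (4 * r ^ 2 * D ^ 2 + L ^ 2)) * a := by
    calc _ = (L + 2 * r * D + K * (4 * r ^ 2 * D ^ 2)) * a + K * L ^ 2 * (a * a) := by
          rw [hL]; ring
      _ ≤ (L + 2 * r * D + K * (4 * r ^ 2 * D ^ 2)) * a + K * L ^ 2 * a := by gcongr
      _ = _ := by ring
  have hfix := hstab m ⟨hm0, hm1⟩
  have htri : |phiFn V G β m - m| ≤
      |m - Phi (Psi V G β m + t)| + |Phi (Psi V G β m + t) - Phi (Psi V G β m)| := by
    rw [phiFn, abs_sub_comm]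
    exact abs_sub_le _ _ _
  rw [div_mul_eq_mul_div, le_div_iff₀ hc]
  linarith

lemma mean_ergmWeight_mono (hβ : ∀ i, 0 < β i) (e : EdgeSet n) :
    Monotone fun t ↦ mean (ergmWeight V G β t) (present {e}) := fun _ _ h ↦
  mean_gibbsWeight_mono (copyCoeff_nonneg hβ) (fun _ ↦ h) (present_monotone _)

/-- In a window of length `a` the susceptibility is somewhere at most `1 / a`. -/
lemma exists_covar_le_inv (e : EdgeSet n) {b a : ℝ} (ha : 0 < a) :
    ∃ t ∈ Set.Ioo b (b + a),
      covar (ergmWeight V G β t) (present {e}) (∑ f, present {f}) ≤ a⁻¹ := by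
  set m : ℝ → ℝ := fun t ↦ mean (ergmWeight V G β t) (present {e})
  have hd (t : ℝ) : HasDerivAt m
      (covar (ergmWeight V G β t) (present {e}) (∑ f, present {f})) t :=
    hasDerivAt_mean_gibbsWeight _ _ _ _
  obtain ⟨t, ht, h⟩ := exists_hasDerivAt_eq_slope m _ (lt_add_of_pos_right b ha)
    (fun t _ ↦ (hd t).continuousAt.continuousWithinAt) fun t _ ↦ hd t
  refine ⟨t, ht, ?_⟩
  have h0 : 0 ≤ m b := mean_nonneg (ergmWeight_pos b) fun x ↦ present_nonneg _ x
  have h1 : m (b + a) ≤ 1 := by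
    rw [← mean_const (ergmWeight_pos (V := V) (G := G) (β := β) (n := n) (b + a)) 1]
    exact mean_mono (ergmWeight_pos _) fun x ↦ present_le_one _ x
  rw [h, add_sub_cancel_left, div_eq_mul_inv]
  exact mul_le_of_le_one_left (inv_pos.2 ha).le (by linarith)

/-- In the sub-critical regime, the edge density is within `O(1 / √n)` of the fixed point, uniformly
over external fields of size at most `1 / √n`. -/
theorem exists_abs_marginal_sub_le (hβ : ∀ i, 0 < β i) (hsub : Subcritical V G β p) :
    ∃ C : ℝ, 0 ≤ C ∧ ∃ N : ℕ, 0 < N ∧ ∀ n : ℕ, N ≤ n → ∀ (e : EdgeSet n) (t : ℝ),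
      |t| ≤ (√n)⁻¹ → |mean (ergmWeight V G β t) (present {e}) - p| ≤ C * (√n)⁻¹ := by
  obtain ⟨C, hC, N, hN, h⟩ := exists_abs_marginal_sub_le_of_covar_le hβ hsub
  refine ⟨C, hC, N, hN, fun n hn e t ht ↦ ?_⟩
  have hn0 : (0 : ℝ) < n := by exact_mod_cast hN.trans_le hn
  set a := (√(n : ℝ))⁻¹ with ha
  have ha0 : 0 < a := inv_pos.2 (Real.sqrt_pos.2 hn0)
  have hai : a⁻¹ = √(n : ℝ) := inv_inv _
  obtain ⟨ht0, ht1⟩ := abs_le.1 ht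
  obtain ⟨t₁, ⟨h₁, h₁'⟩, hc₁⟩ := exists_covar_le_inv (V := V) (G := G) (β := β) e (b := a) ha0
  obtain ⟨t₂, ⟨h₂, h₂'⟩, hc₂⟩ :=
    exists_covar_le_inv (V := V) (G := G) (β := β) e (b := -(2 * a)) ha0
  have hm₁ := abs_le.1 (h n hn e t₁ (abs_le.2 ⟨by linarith, by linarith⟩) (hai ▸ hc₁))
  have hm₂ := abs_le.1 (h n hn e t₂ (abs_le.2 ⟨by linarith, by linarith⟩) (hai ▸ hc₂))
  have hle₁ := mean_ergmWeight_mono (V := V) (G := G) hβ e (by linarith : t ≤ t₁)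
  have hle₂ := mean_ergmWeight_mono (V := V) (G := G) hβ e (by linarith : t₂ ≤ t)
  simp only at hle₁ hle₂
  exact abs_le.2 ⟨by linarith, by linarith⟩

end Marginal

section ExponentialMoment

/-- Jensen's inequality for the inverse change of measure. -/
lemma mean_exp_le_exp_mean {Ω : Type*} [Fintype Ω] [Nonempty Ω] {w : Ω → ℝ} (hw : ∀ x, 0 < w x)
    (F : Ω → ℝ) : mean w (fun x ↦ Real.exp (F x)) ≤
      Real.exp (mean (w * fun x ↦ Real.exp (F x)) F) := by
  set w' : Ω → ℝ := w * fun x ↦ Real.exp (F x) with hw'_def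
  have hw' : ∀ x, 0 < w' x := fun x ↦ mul_pos (hw x) (Real.exp_pos _)
  set μ := mean w' F with hμ
  have hlin : mean w' (fun x ↦ 1 + (μ - F x)) = 1 := by
    have h : (fun x ↦ 1 + (μ - F x)) = (fun _ ↦ 1 + μ) - F := by
      ext x
      simp only [Pi.sub_apply]
      ring
    rw [h, map_sub, mean_const hw', ← hμ, add_sub_cancel_right]
  have hge : 1 ≤ mean w' fun x ↦ Real.exp (μ - F x) := by
    rw [← hlin]
    exact mean_mono hw' fun x ↦ by
      simpa [add_comm] using Real.add_one_le_exp (μ - F x)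
  have hZ := sum_pos_of_weight_pos hw
  have hZ' := sum_pos_of_weight_pos hw'
  have hnum : ∑ x, w' x * Real.exp (μ - F x) = Real.exp μ * ∑ x, w x := by
    rw [mul_sum]
    refine sum_congr rfl fun x _ ↦ ?_
    rw [hw'_def, Pi.mul_apply, mul_assoc, ← Real.exp_add, add_sub_cancel, mul_comm]
  rw [mean_apply, hnum, one_le_div hZ'] at hge
  rw [mean_apply, div_le_iff₀ hZ]
  exact hge

variable {n s : ℕ} {V : Fin s → ℕ} {G : ∀ i, SimpleGraph (Fin (V i))} {β : Fin s → ℝ}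

lemma mean_exp_sum_present_le (hβ : ∀ i, 0 < β i) (M : Finset (EdgeSet n)) (t m : ℝ)
    (hm : ∀ e : EdgeSet n, mean (ergmWeight V G β t) (present {e}) = m) :
    mean (ergmWeight V G β 0) (fun x ↦ Real.exp (t * ∑ e ∈ M, present {e} x)) ≤
      Real.exp (t * (#M * m)) := by
  refine (mean_exp_le_exp_mean (ergmWeight_pos 0) _).trans (Real.exp_le_exp.2 ?_)
  set θ : EdgeSet n → ℝ := fun e ↦ if e ∈ M then t else 0 with hθ
  have hw : (ergmWeight V G β 0 * fun x ↦ Real.exp (t * ∑ e ∈ M, present {e} x)) =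
      gibbsWeight (copyCoeff V β) (copySet V G) θ := by
    rw [gibbsWeight_eq_mul (fun _ ↦ 0) θ, ergmWeight]
    simp only [hθ, sub_zero, ite_mul, zero_mul, sum_ite_mem, univ_inter, mul_sum]
  have hF : (fun x : Config n ↦ t * ∑ e ∈ M, present {e} x) = t • ∑ e ∈ M, present {e} := by
    ext x
    simp
  rw [hw, hF, map_smul, map_sum, smul_eq_mul, mul_sum, ← nsmul_eq_mul, ← sum_const, mul_sum]
  refine sum_le_sum fun e _ ↦ ?_
  rw [← hm e, ergmWeight]
  rcases le_total 0 t with ht | ht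
  · refine mul_le_mul_of_nonneg_left (mean_gibbsWeight_mono (copyCoeff_nonneg hβ) (fun f ↦ ?_)
      (present_monotone _)) ht
    simp only [hθ]
    split_ifs <;> simp [ht]
  · refine mul_le_mul_of_nonpos_left (mean_gibbsWeight_mono (copyCoeff_nonneg hβ) (fun f ↦ ?_)
      (present_monotone _)) ht
    simp only [hθ]
    split_ifs <;> simp [ht]

variable (V G β) in
/-- The centred indicator of the presence of an edge under the ERGM measure. -/
noncomputable def centeredEdge (e : EdgeSet n) (x : Config n) : ℝ :=
  present {e} x - mean (ergmWeight V G β 0) (present {e})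

/-- Exponential moments at scale `1 / √n` of the centred number of edges among at most `n` edges. -/
lemma mean_exp_mul_sum_centeredEdge_le (hβ : ∀ i, 0 < β i) {p C : ℝ} (hC : 0 ≤ C)
    (hmarg : ∀ (e : EdgeSet n) (t : ℝ),
      |t| ≤ (√n)⁻¹ → |mean (ergmWeight V G β t) (present {e}) - p| ≤ C * (√n)⁻¹)
    (M : Finset (EdgeSet n)) (hM : #M ≤ n) {t : ℝ} (ht : |t| ≤ (√n)⁻¹) :
    mean (ergmWeight V G β 0) (fun x ↦ Real.exp (t * ∑ e ∈ M, centeredEdge V G β e x)) ≤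
      Real.exp (2 * C) := by
  rcases M.eq_empty_or_nonempty with rfl | ⟨e₀, -⟩
  · simp only [sum_empty, mul_zero, Real.exp_zero]
    rw [mean_const (ergmWeight_pos 0)]
    exact Real.one_le_exp (by positivity)
  set a := (√(n : ℝ))⁻¹ with ha
  have ha0 : 0 ≤ a := by positivity
  set m₀ := mean (ergmWeight V G β 0) (present {e₀}) with hm₀
  set m := mean (ergmWeight V G β t) (present {e₀}) with hm
  have hsum (x : Config n) : Real.exp (t * ∑ e ∈ M, centeredEdge V G β e x) =
      Real.exp (-(t * (#M * m₀))) * Real.exp (t * ∑ e ∈ M, present {e} x) := by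
    rw [← Real.exp_add]
    congr 1
    simp only [centeredEdge, fun e ↦ mean_present_eq (V := V) (G := G) (β := β) 0 e e₀,
      sum_sub_distrib, sum_const, nsmul_eq_mul]
    ring
  have hfun : (fun x ↦ Real.exp (t * ∑ e ∈ M, centeredEdge V G β e x)) =
      Real.exp (-(t * (#M * m₀))) • fun x ↦ Real.exp (t * ∑ e ∈ M, present {e} x) :=
    funext hsum
  rw [hfun, map_smul, smul_eq_mul]
  refine (mul_le_mul_of_nonneg_left (mean_exp_sum_present_le hβ M t m
    fun e ↦ mean_present_eq t e e₀) (Real.exp_pos _).le).trans ?_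
  rw [← Real.exp_add]
  refine Real.exp_le_exp.2 ?_
  have hdiff : |m - m₀| ≤ 2 * C * a := by
    have h1 := hmarg e₀ t ht
    have h2 := hmarg e₀ 0 (by simpa using ha0)
    rw [abs_le] at h1 h2 ⊢
    constructor <;> linarith
  have hMa : (#M : ℝ) * (a * a) ≤ 1 := by
    rw [ha, ← mul_inv, Real.mul_self_sqrt n.cast_nonneg]
    exact mul_inv_le_one_of_le₀ (by exact_mod_cast hM) n.cast_nonneg
  calc -(t * (#M * m₀)) + t * (#M * m) = #M * (t * (m - m₀)) := by ring
    _ ≤ #M * (a * (2 * C * a)) := by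
      refine mul_le_mul_of_nonneg_left ((le_abs_self _).trans ?_) (Nat.cast_nonneg _)
      rw [abs_mul]
      exact mul_le_mul ht hdiff (abs_nonneg _) ha0
    _ = 2 * C * (#M * (a * a)) := by ring
    _ ≤ 2 * C * 1 := by gcongr
    _ = 2 * C := mul_one _

end ExponentialMoment

section Correlation

lemma exists_not_shareVertex {ι : Type*} [Fintype ι] {n : ℕ} (h : 2 * Fintype.card ι ≤ n) :
    ∃ e : ι → EdgeSet n, ∀ q q', q ≠ q' → ¬ ShareVertex (e q) (e q') := by
  obtain ⟨φ⟩ := Function.Embedding.nonempty_of_card_le (α := ι × Bool) (β := Fin n)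
    (by simpa [mul_comm] using h)
  refine ⟨fun q ↦ ⟨s(φ (q, false), φ (q, true)), by simp⟩, fun q q' hq ↦ ?_⟩
  rintro ⟨v, hv, hv'⟩
  simp only [Sym2.mem_iff] at hv hv'
  rcases hv with rfl | rfl <;> rcases hv' with hv' | hv' <;>
    exact hq (congrArg Prod.fst (φ.injective hv'))

lemma injective_of_not_shareVertex {ι : Type*} {n : ℕ} {e : ι → EdgeSet n}
    (h : ∀ q q', q ≠ q' → ¬ ShareVertex (e q) (e q')) : Function.Injective e := by
  intro q q' hq
  by_contra hne
  refine h q q' hne ⟨(Quot.out (e q).1).1, Sym2.out_fst_mem _, ?_⟩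
  rw [← hq]
  exact Sym2.out_fst_mem _

lemma abs_prod_le_factorial_mul_sum_exp {k : ℕ} (hk : 0 < k) (y : Fin k → ℝ) :
    |∏ j, y j| ≤ ∑ j, (k.factorial : ℝ) * (Real.exp (y j) + Real.exp (-y j)) := by
  have : Nonempty (Fin k) := ⟨⟨0, hk⟩⟩
  obtain ⟨j₀, -, hj₀⟩ := exists_max_image univ (fun j ↦ |y j|) univ_nonempty
  have hexp : Real.exp |y j₀| ≤ Real.exp (y j₀) + Real.exp (-y j₀) := by
    rcases abs_choice (y j₀) with h | h <;> rw [h]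
    · linarith [Real.exp_pos (-y j₀)]
    · linarith [Real.exp_pos (y j₀)]
  have hpow := Real.pow_div_factorial_le_exp _ (abs_nonneg (y j₀)) k
  rw [div_le_iff₀ (by positivity)] at hpow
  calc |∏ j, y j| = ∏ j, |y j| := abs_prod _ _
    _ ≤ ∏ _j : Fin k, |y j₀| := prod_le_prod (fun _ _ ↦ abs_nonneg _) hj₀
    _ = |y j₀| ^ k := by simp
    _ ≤ Real.exp |y j₀| * k.factorial := hpow
    _ ≤ k.factorial * (Real.exp (y j₀) + Real.exp (-y j₀)) := by
      rw [mul_comm]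
      gcongr
    _ ≤ _ := single_le_sum
      (f := fun j ↦ (k.factorial : ℝ) * (Real.exp (y j) + Real.exp (-y j)))
      (fun j _ ↦ by positivity) (mem_univ j₀)

variable {n s : ℕ} {V : Fin s → ℕ} {G : ∀ i, SimpleGraph (Fin (V i))} {β : Fin s → ℝ}

/-- The centred correlation of `k` pairwise disjoint edges does not depend on the edges. -/
lemma mean_prod_centeredEdge_eq {k : ℕ} {i i' : Fin k → EdgeSet n}
    (hi : ∀ q q', q ≠ q' → ¬ ShareVertex (i q) (i q'))
    (hi' : ∀ q q', q ≠ q' → ¬ ShareVertex (i' q) (i' q')) :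
    mean (ergmWeight V G β 0) (fun x ↦ ∏ r, centeredEdge V G β (i r) x) =
      mean (ergmWeight V G β 0) (fun x ↦ ∏ r, centeredEdge V G β (i' r) x) := by
  obtain ⟨σ, hσ⟩ := exists_edgePerm_eq i' i hi' hi
  rw [← mean_comp_equiv _ (ergmWeight_permConfig 0 σ) fun x ↦ ∏ r, centeredEdge V G β (i' r) x]
  congr 1
  ext x
  refine prod_congr rfl fun r _ ↦ ?_
  rw [← hσ r, centeredEdge, centeredEdge, mean_present_edgePerm,
    ← present_singleton_comp_permConfig, Function.comp_apply]

/-- The `k`-fold centred correlation is controlled by the exponential moments of the centred number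
of edges in `k` disjoint matchings of size `l`. -/
lemma abs_mean_prod_centeredEdge_mul_le {k l : ℕ} (hk : 0 < k) (hl : 2 * (k * l) ≤ n)
    {i : Fin k → EdgeSet n} (hi : ∀ q q', q ≠ q' → ¬ ShareVertex (i q) (i q')) {a A : ℝ}
    (ha : 0 ≤ a)
    (hexp : ∀ t, |t| ≤ a → ∀ M : Finset (EdgeSet n), #M ≤ n → mean (ergmWeight V G β 0)
      (fun x ↦ Real.exp (t * ∑ e ∈ M, centeredEdge V G β e x)) ≤ A) :
    |mean (ergmWeight V G β 0) (fun x ↦ ∏ r, centeredEdge V G β (i r) x)| * (l * a) ^ k ≤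
      k * (k.factorial * (2 * A)) := by
  obtain ⟨e, he⟩ := exists_not_shareVertex (ι := Fin k × Fin l) (n := n) (by simpa using hl)
  set w := ergmWeight V G β (n := n) 0 with hw_def
  have hw : ∀ x, 0 < w x := ergmWeight_pos 0
  set E := mean w (fun x ↦ ∏ r, centeredEdge V G β (i r) x) with hE
  set y : Fin k → Config n → ℝ := fun j x ↦ a * ∑ q, centeredEdge V G β (e (j, q)) x with hy
  have hprod : mean w (fun x ↦ ∏ j, y j x) = E * (l * a) ^ k := by
    have h1 : (fun x ↦ ∏ j, y j x) =
        a ^ k • ∑ g : Fin k → Fin l, fun x ↦ ∏ j, centeredEdge V G β (e (j, g j)) x := by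
      ext x
      simp only [hy, prod_mul_distrib, prod_const, card_univ, Fintype.card_fin, Pi.smul_apply,
        Finset.sum_apply, smul_eq_mul, prod_univ_sum, Fintype.piFinset_univ]
    have h2 (g : Fin k → Fin l) :
        mean w (fun x ↦ ∏ j, centeredEdge V G β (e (j, g j)) x) = E :=
      mean_prod_centeredEdge_eq (fun q q' hq ↦ he _ _ fun h ↦ hq (congrArg Prod.fst h)) hi
    rw [h1, map_smul, map_sum]
    simp only [h2, sum_const, card_univ, Fintype.card_pi_const, Fintype.card_fin, smul_eq_mul,
      nsmul_eq_mul, Nat.cast_pow]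
    ring
  have hmoment (j : Fin k) {t : ℝ} (ht : |t| ≤ a) :
      mean w (fun x ↦ Real.exp (t * ∑ q, centeredEdge V G β (e (j, q)) x)) ≤ A := by
    have hinj : Function.Injective fun q ↦ e (j, q) := fun q q' h ↦
      congrArg Prod.snd (injective_of_not_shareVertex he h)
    have hcard : #(univ.map ⟨_, hinj⟩) ≤ n := by
      rw [card_map, card_univ, Fintype.card_fin]
      nlinarith
    simpa using hexp t ht (univ.map ⟨_, hinj⟩) hcard
  rw [← abs_of_nonneg (by positivity : 0 ≤ ((l : ℝ) * a) ^ k), ← abs_mul, ← hprod]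
  refine (abs_mean_le hw _).trans ?_
  refine (mean_mono hw (g := ∑ j, (k.factorial : ℝ) •
    ((fun x ↦ Real.exp (a * ∑ q, centeredEdge V G β (e (j, q)) x)) +
      fun x ↦ Real.exp (-a * ∑ q, centeredEdge V G β (e (j, q)) x))) fun x ↦ ?_).trans ?_
  · simpa [hy, mul_add] using abs_prod_le_factorial_mul_sum_exp hk fun j ↦ y j x
  · simp only [map_sum, map_smul, map_add, smul_eq_mul]
    refine (sum_le_card_nsmul univ _ (k.factorial * (2 * A)) fun j _ ↦ ?_).trans_eq (by simp)
    have h1 := hmoment j (abs_of_nonneg ha).le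
    have h2 := hmoment j (t := -a) (by rw [abs_neg, abs_of_nonneg ha])
    gcongr
    linarith

end Correlation

/-- **(`k`-correlation estimate for vertex-disjoint edges).**
For every fixed `k ≥ 1` there is `C > 0` such that for all sufficiently large `n` and
any `k` distinct edges `i_1, …, i_k` no two of which share a vertex,
`|𝔼[(X_{i_1} - 𝔼X_{i_1}) ⋯ (X_{i_k} - 𝔼X_{i_k})]| ≤ C n^{-k/2}`. -/
theorem k_correlation_bound {s : ℕ} (V : Fin s → ℕ)
    (G : ∀ i, SimpleGraph (Fin (V i))) (β : Fin s → ℝ) (hβ : ∀ i, 0 < β i)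
    (p : ℝ) (hsub : Subcritical V G β p) (k : ℕ) (hk : 0 < k) :
    ∃ C : ℝ, 0 < C ∧ ∃ N : ℕ, ∀ n : ℕ, N ≤ n →
      ∀ i : Fin k → EdgeSet n,
        (∀ q q' : Fin k, q ≠ q' → ¬ ShareVertex (i q) (i q')) →
        |expect (ergmProb V G β)
            (fun x => ∏ r : Fin k,
              (edgeX (i r) x - expect (ergmProb V G β) (edgeX (i r))))| ≤
          C / (n : ℝ) ^ ((k : ℝ) / 2) := by
  obtain ⟨C, hC, N, hN, hmarg⟩ := exists_abs_marginal_sub_le hβ hsub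
  have hk' : (0 : ℝ) < k := by exact_mod_cast hk
  refine ⟨k * (k.factorial * (2 * Real.exp (2 * C))) * (4 * k) ^ k, by positivity, N + 4 * k,
    fun n hn i hi ↦ ?_⟩
  have hn0 : (0 : ℝ) < n := by exact_mod_cast (by omega : 0 < n)
  have hs0 : 0 < √(n : ℝ) := Real.sqrt_pos.2 hn0
  set l := n / (2 * k) with hl
  have hln : 2 * (k * l) ≤ n := by
    rw [← mul_assoc]
    exact Nat.mul_div_le n (2 * k)
  have h := abs_mean_prod_centeredEdge_mul_le (V := V) (G := G) (β := β) hk hln hi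
    (inv_nonneg.2 hs0.le) (A := Real.exp (2 * C)) fun t ht M hM ↦
      mean_exp_mul_sum_centeredEdge_le hβ hC (hmarg n (by omega)) M hM ht
  have hll : (n : ℝ) ≤ 4 * k * l := by
    have h1 : n < 2 * k * (l + 1) := Nat.lt_mul_div_succ n (by omega)
    have h2 : n ≤ 4 * k * l := by nlinarith
    exact_mod_cast h2
  have hla : √(n : ℝ) ≤ 4 * k * (l * (√(n : ℝ))⁻¹) := by
    rw [← mul_assoc, ← div_eq_mul_inv, le_div_iff₀ hs0, Real.mul_self_sqrt hn0.le]
    exact hll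
  have hpow : (n : ℝ) ^ ((k : ℝ) / 2) = √(n : ℝ) ^ k := by
    rw [Real.sqrt_eq_rpow, ← Real.rpow_natCast, ← Real.rpow_mul hn0.le]
    congr 1
    ring
  have htarget : expect (ergmProb V G β) (fun x => ∏ r : Fin k,
      (edgeX (i r) x - expect (ergmProb V G β) (edgeX (i r)))) =
      mean (ergmWeight V G β 0) (fun x ↦ ∏ r, centeredEdge V G β (i r) x) := by
    simp only [expect_ergmProb, edgeX_eq_present, centeredEdge]
  rw [htarget, hpow, le_div_iff₀ (by positivity)]
  calc _ ≤ |mean (ergmWeight V G β 0) (fun x ↦ ∏ r, centeredEdge V G β (i r) x)| *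
        (4 * k * (l * (√(n : ℝ))⁻¹)) ^ k := by gcongr
    _ = |mean (ergmWeight V G β 0) (fun x ↦ ∏ r, centeredEdge V G β (i r) x)| *
        (l * (√(n : ℝ))⁻¹) ^ k * (4 * k) ^ k := by rw [mul_pow (4 * (k : ℝ))]; ring
    _ ≤ _ := by gcongr

end ERGM
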